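/- Let q be a power of a prime p, k = F_q(t), S = {D_1,...,D_l} nonzero elements of k, and γ_S the cardinality of {(a_1,...,a_l) ∈ F_p^l : a_1 D_1 + ··· + a_l D_l = F^p − F for some F ∈ k}; write γ_S = p^r. Let M be the set of monic irreducible polynomials P (with ord_P(D_i) ≥ 0 for all i) such that the Hasse symbols satisfy {D_1/P} = ··· = {D_l/P} = 0. Then the Dirichlet density of M equals 1/p^{l−r}; that is, lim_{s→1+} (Σ_{P ∈ M} NP^{−s}) / (Σ_P NP^{−s}) = 1/p^{l−r}, where NP = q^{deg P}. Moreover, if K = k(α_1,...,α_l) with α_i^p − α_i = D_i is a geometric extension of k, then the relative density of M also equals 1/p^{l−r}. -/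

import Mathlib

open Polynomial Filter

/-- The Hasse symbol `{D/P} ∈ F_p` of `D ∈ F_q(t)` at a monic irreducible `P ∈ F_q[t]`
(meaningful when `ord_P(D) ≥ 0`, i.e. `P ∤ denom(D)`), defined as
`tr_{F_q/F_p}(tr_{(F_q[t]/(P))/F_q}(D mod P))`, where `D mod P` is computed as
`num(D)·denom(D)⁻¹` in `F_q[t]/(P)`. -/
noncomputable def hasseSymbol (p : ℕ) {Fq : Type} [Field Fq] [Fintype Fq]
    [Algebra (ZMod p) Fq] (P : Polynomial Fq) (D : RatFunc Fq) : ZMod p :=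
  Algebra.trace (ZMod p) Fq (Algebra.trace Fq (AdjoinRoot P)
    (AdjoinRoot.mk P D.num * Ring.inverse (AdjoinRoot.mk P D.denom)))

open scoped WithZero in
/-- Elements with pairwise distinct valuations are not linearly dependent. -/
theorem Valuation.eq_zero_of_sum_eq_zero {K ι : Type*} [Field K] [Fintype ι]
    (v : Valuation K ℤᵐ⁰) (f : ι → K)
    (hf : ∀ i j, f i ≠ 0 → f j ≠ 0 → v (f i) = v (f j) → i = j)
    (h : ∑ i, f i = 0) (i : ι) : f i = 0 := by
  classical
  by_contra hi
  obtain ⟨j, hj, hmax⟩ := Finset.exists_max_image (Finset.univ.filter fun i => f i ≠ 0)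
    (fun i => v (f i)) ⟨i, by simpa using hi⟩
  simp only [Finset.mem_filter, Finset.mem_univ, true_and] at hj hmax
  have := v.map_sum_eq_of_lt (s := Finset.univ) (f := f) (Finset.mem_univ j) (by
    intro k hk
    have hkj : k ≠ j := by simpa using hk
    by_cases h0 : f k = 0
    · rw [h0, map_zero]; exact zero_lt_iff.mpr (by simpa using hj)
    · exact lt_of_le_of_ne (hmax k h0) fun e => hkj (hf _ _ h0 hj e))
  rw [h, map_zero] at this
  exact hj (by simpa using this.symm)

open WithZero in
/-- If `τ` has valuation `exp (±1)` and `g` has valuation `exp (d p ^ n)` with `p ∤ d`, then the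
products `τ ^ i * g ^ j` with `i < p ^ n`, `j < p` are linearly independent over the field of
`p ^ (n + 1)`-th powers. -/
theorem Valuation.coeff_eq_zero_of_sum_pow_mul_pow {K : Type*} [Field K] {p : ℕ} (hp : p.Prime)
    (v : Valuation K ℤᵐ⁰) {τ g : K} {n : ℕ} {ε d : ℤ} (hε : ε = 1 ∨ ε = -1)
    (hτ : v τ = exp ε) (hg : v g = exp (d * p ^ n)) (hd : ¬ (p : ℤ) ∣ d)
    (c : Fin (p ^ n) → Fin p → K)
    (h : ∑ i : Fin (p ^ n), ∑ j : Fin p, τ ^ (i : ℕ) * g ^ (j : ℕ) * c i j ^ p ^ (n + 1) = 0) : c = 0 := by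
  have hp0 : p ^ n ≠ 0 := pow_ne_zero _ hp.ne_zero
  have hτ0 : τ ≠ 0 := by rintro rfl; exact exp_ne_zero (hτ.symm.trans v.map_zero)
  have hg0 : g ≠ 0 := by rintro rfl; exact exp_ne_zero (hg.symm.trans v.map_zero)
  rw [← Fintype.sum_prod_type'] at h
  have key := v.eq_zero_of_sum_eq_zero
    (fun x : Fin (p ^ n) × Fin p => τ ^ (x.1 : ℕ) * g ^ (x.2 : ℕ) * c x.1 x.2 ^ p ^ (n + 1)) ?_ h
  · ext i j
    have := key (i, j)
    simpa [hτ0, hg0, hp.ne_zero] using this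
  rintro ⟨i, j⟩ ⟨i', j'⟩ h1 h2 h3
  have hc1 : c i j ≠ 0 := by
    rintro e; simp [e, hp.ne_zero] at h1
  have hc2 : c i' j' ≠ 0 := by
    rintro e; simp [e, hp.ne_zero] at h2
  obtain ⟨m, hm⟩ : ∃ m : ℤ, v (c i j) = exp m :=
    ⟨_, (exp_log ((Valuation.ne_zero_iff v).mpr hc1)).symm⟩
  obtain ⟨m', hm'⟩ : ∃ m : ℤ, v (c i' j') = exp m :=
    ⟨_, (exp_log ((Valuation.ne_zero_iff v).mpr hc2)).symm⟩
  simp only [map_mul, map_pow, hτ, hg, hm, hm', ← exp_nsmul, ← exp_add, exp_inj,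
    nsmul_eq_mul] at h3
  push_cast at h3
  have hPn : (p : ℤ) ^ n ≠ 0 := by exact_mod_cast hp0
  have h4 : ε * ((i : ℤ) - i') = (p : ℤ) ^ n * (d * (j' - j) + p * (m' - m)) := by
    rw [pow_succ'] at h3; linear_combination h3
  have h5 : (i : ℤ) - i' = 0 := by
    apply Int.eq_zero_of_abs_lt_dvd (m := (p : ℤ) ^ n)
    · rcases hε with rfl | rfl
      · exact ⟨d * (j' - j) + p * (m' - m), by linear_combination h4⟩
      · exact ⟨-(d * (j' - j) + p * (m' - m)), by linear_combination -h4⟩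
    · have h1 := i.2
      have h2 := i'.2
      zify at h1 h2
      rw [abs_lt]; constructor <;> linarith [Int.natCast_nonneg (i : ℕ), Int.natCast_nonneg (i' : ℕ)]
  have h6 : d * ((j' : ℤ) - j) + p * (m' - m) = 0 := by
    rw [h5, mul_zero] at h4
    exact (mul_eq_zero.mp h4.symm).resolve_left hPn
  have h7 : (j' : ℤ) - j = 0 := by
    apply Int.eq_zero_of_abs_lt_dvd (m := (p : ℤ))
    · exact ((Nat.prime_iff_prime_int.mp hp).dvd_mul.mp
        ⟨-(m' - m), by linear_combination h6⟩).resolve_left hd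
    · have h1 := j.2
      have h2 := j'.2
      zify at h1 h2
      rw [abs_lt]; constructor <;> linarith [Int.natCast_nonneg (j : ℕ), Int.natCast_nonneg (j' : ℕ)]
  ext <;> simp <;> omega

open WithZero in
theorem Valuation.map_sum_pow_prime_pow {K : Type*} [Field K] {p : ℕ} (hp : p.Prime)
    (v : Valuation K ℤᵐ⁰) {D : K} {d : ℤ} (hd : 0 < d) (hD : v D = exp d) (n : ℕ) :
    v (∑ i ∈ Finset.range (n + 1), D ^ p ^ i) = exp (d * p ^ n) := by
  rw [v.map_sum_eq_of_lt (j := n) (by simp)]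
  · rw [map_pow, hD, ← exp_nsmul, nsmul_eq_mul, mul_comm]; push_cast; rfl
  · intro i hi
    have hi : i < n := by simp at hi; omega
    simp only [map_pow, hD, ← exp_nsmul, nsmul_eq_mul, exp_lt_exp]
    have : p ^ i < p ^ n := Nat.pow_lt_pow_right hp.one_lt hi
    exact mul_lt_mul_of_pos_right (by exact_mod_cast this) hd

/-- The Artin–Schreier polynomial `X ^ p - X - D`. -/
noncomputable def artinSchreierPoly {R : Type*} [CommRing R] (p : ℕ) (D : R) : R[X] :=
  X ^ p - X - C D

theorem artinSchreierPoly_eq {R : Type*} [CommRing R] (p : ℕ) (D : R) :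
    artinSchreierPoly p D = X ^ p - (X + C D) := by
  rw [artinSchreierPoly, sub_sub]

theorem artinSchreierPoly_monic {R : Type*} [CommRing R] [Nontrivial R] {p : ℕ} (hp : 1 < p)
    (D : R) : (artinSchreierPoly p D).Monic := by
  rw [artinSchreierPoly_eq]
  exact monic_X_pow_sub (by rw [degree_X_add_C]; exact_mod_cast hp)

theorem artinSchreierPoly_natDegree {R : Type*} [CommRing R] [Nontrivial R] {p : ℕ} (hp : 1 < p)
    (D : R) : (artinSchreierPoly p D).natDegree = p := by
  rw [artinSchreierPoly_eq, natDegree_sub_eq_left_of_natDegree_lt]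
  · simp
  · rw [natDegree_X_add_C]; simpa using hp

/-- Iterating `y ^ p = y + D`. -/
theorem pow_prime_pow_eq_add_sum {R : Type*} [CommRing R] {p : ℕ} [Fact p.Prime] [CharP R p]
    {y D : R} (h : y ^ p = y + D) (n : ℕ) :
    y ^ p ^ n = y + ∑ i ∈ Finset.range n, D ^ p ^ i := by
  induction n with
  | zero => simp
  | succ n ih =>
    rw [pow_succ', pow_mul, h, add_pow_char_pow, ih, Finset.sum_range_succ, add_assoc]

/-- Linear independence of the products `τ ^ i * y ^ j` over the ring of `p ^ n`-th powers in
the algebra `K[y]`, `y ^ p - y = D`. -/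
theorem AdjoinRoot.eq_zero_of_sum_mul_root_pow_mul_pow {K : Type*} [Field K] {p : ℕ}
    [Fact p.Prime] [CharP K p] {D τ : K} {n A : ℕ} {f : K[X]} (hf : f = artinSchreierPoly p D)
    (hind : ∀ c : Fin A → Fin p → K, ∑ i : Fin A, ∑ j : Fin p, τ ^ (i : ℕ) *
      (∑ k ∈ Finset.range n, D ^ p ^ k) ^ (j : ℕ) * c i j ^ p ^ n = 0 → c = 0)
    (u : Fin A → Fin p → AdjoinRoot f)
    (h : ∑ i : Fin A, ∑ j : Fin p, AdjoinRoot.of f τ ^ (i : ℕ) *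
      AdjoinRoot.root f ^ (j : ℕ) * u i j ^ p ^ n = 0) : u = 0 := by
  have hp : p.Prime := Fact.out
  have hmon : f.Monic := hf ▸ artinSchreierPoly_monic hp.one_lt D
  have hdeg : f.natDegree = p := hf ▸ artinSchreierPoly_natDegree hp.one_lt D
  have hdeg' : f.degree = p := by rw [degree_eq_natDegree hmon.ne_zero, hdeg]
  have hof : Function.Injective (AdjoinRoot.of f) :=
    AdjoinRoot.of.injective_of_degree_ne_zero (by rw [hdeg']; exact_mod_cast hp.ne_zero)
  have : CharP (AdjoinRoot f) p := charP_of_injective_ringHom hof p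
  have : Nontrivial (AdjoinRoot f) := hof.nontrivial
  set y := AdjoinRoot.root f with hy
  set g := ∑ k ∈ Finset.range n, D ^ p ^ k with hg
  have hy1 : y ^ p = y + AdjoinRoot.of f D := by
    have := AdjoinRoot.eval₂_root f
    rw [← hy] at this
    have h2 := congrArg (eval₂ (AdjoinRoot.of f) y) hf
    rw [this, artinSchreierPoly, eq_comm] at h2
    simp only [eval₂_sub, eval₂_X_pow, eval₂_X, eval₂_C] at h2
    rwa [sub_sub, sub_eq_zero] at h2
  have hyg : y ^ p ^ n = y + AdjoinRoot.of f g := by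
    rw [pow_prime_pow_eq_add_sum hy1, hg]; simp
  -- the powers of `y + g` are linearly independent
  have hli : ∀ m : K[X], m.degree < p → m.eval₂ (AdjoinRoot.of f) (y ^ p ^ n) = 0 → m = 0 := by
    intro m hm h0
    have h1 : AdjoinRoot.mk f (m.comp (X + C g)) = 0 := by
      rw [← AdjoinRoot.aeval_eq, aeval_def, eval₂_comp]
      simp only [eval₂_add, eval₂_X, eval₂_C]
      rw [hyg] at h0
      exact h0
    rw [AdjoinRoot.mk_eq_zero] at h1
    have h2 : m.comp (X + C g) = 0 := by
      by_contra hne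
      have := degree_le_of_dvd h1 hne
      have hm0 : m ≠ 0 := by rintro rfl; simp at hne
      rw [hdeg', degree_eq_natDegree hne, natDegree_comp, natDegree_X_add_C, mul_one,
        ← degree_eq_natDegree hm0] at this
      exact absurd hm (not_lt.mpr this)
    have h3 : (m.comp (X + C g)).comp (X - C g) = m := by
      rw [comp_assoc]; simp
    rw [← h3, h2, zero_comp]
  have hindS : ∀ T : Fin A → Fin p → AdjoinRoot f, ∑ i : Fin A, ∑ j : Fin p, AdjoinRoot.of f τ ^ (i : ℕ) *
      (AdjoinRoot.of f g) ^ (j : ℕ) * T i j ^ p ^ n = 0 → T = 0 := by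
    intro T hT
    have hrep : ∀ s : AdjoinRoot f, ∃ c : Fin p → K, s = ∑ t : Fin p, AdjoinRoot.of f (c t) * y ^ (t : ℕ) := by
      intro s
      obtain ⟨q, rfl⟩ := AdjoinRoot.mk_surjective s
      refine ⟨fun t => (q %ₘ f).coeff t, ?_⟩
      have : AdjoinRoot.mk f q = AdjoinRoot.mk f (q %ₘ f) := by
        conv_lhs => rw [← modByMonic_add_div q f]
        simp
      rw [this, ← AdjoinRoot.aeval_eq, aeval_def, eval₂_eq_sum_range' _
        (show (q %ₘ f).natDegree < p by
          exact (natDegree_modByMonic_lt _ hmon (by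
            intro h1; rw [h1] at hdeg; simp at hdeg; exact hp.ne_zero hdeg.symm)).trans_eq hdeg),
        Finset.sum_range]
      rfl
    choose c hc using fun i j => hrep (T i j)
    have hz : ∀ t : Fin p, (fun i j => c i j t) = 0 := by
      intro t
      apply hind
      set m : K[X] := ∑ t : Fin p, C (∑ i : Fin A, ∑ j : Fin p, τ ^ (i : ℕ) * g ^ (j : ℕ) * c i j t ^ p ^ n) *
        X ^ (t : ℕ) with hm
      have hm0 : m = 0 := by
        apply hli
        · refine (degree_sum_le _ _).trans_lt ?_
          rw [Finset.sup_lt_iff (by exact_mod_cast WithBot.bot_lt_coe p)]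
          intro t _
          exact (degree_C_mul_X_pow_le _ _).trans_lt (by exact_mod_cast t.2)
        · rw [hm, eval₂_finsetSum, ← hT]
          simp only [eval₂_mul, eval₂_C, eval₂_X_pow]
          simp only [map_sum, map_mul, map_pow, hc,
            sum_pow_char_pow, mul_pow, Finset.sum_mul, Finset.mul_sum]
          rw [Finset.sum_comm]
          refine Finset.sum_congr rfl fun i _ => ?_
          rw [Finset.sum_comm]
          refine Finset.sum_congr rfl fun j _ => Finset.sum_congr rfl fun t _ => ?_
          rw [← pow_mul, ← pow_mul, mul_comm (p ^ n)]
          ring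
      have := congrArg (fun q => q.coeff t) hm0
      simpa only [hm, finsetSum_coeff, coeff_C_mul_X_pow, Fin.val_inj, Finset.sum_ite_eq,
        Finset.mem_univ, if_true, coeff_zero] using this
    ext i j
    rw [hc]
    exact Finset.sum_eq_zero fun t _ => by
      rw [show c i j t = 0 from congrFun (congrFun (hz t) i) j]; simp
  -- substitute `y = y ^ (p ^ n) - g`
  let U : Fin A → (AdjoinRoot f)[X] := fun i => ∑ j : Fin p, C (u i j) * X ^ (j : ℕ)
  let T : Fin A → (AdjoinRoot f)[X] := fun i => (U i).comp (C y - X)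
  have hUdeg : ∀ i, (U i).natDegree < p := by
    intro i
    refine lt_of_le_of_lt (natDegree_sum_le_of_forall_le (n := p - 1) _ _ fun j _ => ?_)
      (Nat.sub_lt hp.pos one_pos)
    exact (natDegree_C_mul_X_pow_le _ _).trans (Nat.le_sub_one_of_lt j.2)
  have hCX : (C y - X : (AdjoinRoot f)[X]).natDegree ≤ 1 := by
    refine (natDegree_sub_le _ _).trans ?_; simp
  have hTdeg : ∀ i, (T i).natDegree < p := by
    intro i
    refine lt_of_le_of_lt natDegree_comp_le ?_
    exact lt_of_le_of_lt (Nat.mul_le_mul_left _ hCX) (by simpa using hUdeg i)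
  let φ := iterateFrobenius (AdjoinRoot f) p n
  have hφ : ∀ x, φ x = x ^ p ^ n := fun x => iterateFrobenius_def p n x
  have hTU : ∀ i, (T i).eval₂ φ (AdjoinRoot.of f g) = ∑ j : Fin p, y ^ (j : ℕ) * u i j ^ p ^ n := by
    intro i
    simp only [T, eval₂_comp, eval₂_sub, eval₂_C, eval₂_X, hφ, hyg, add_sub_cancel_right]
    simp only [U, eval₂_finsetSum, eval₂_mul, eval₂_C, eval₂_X_pow, hφ]
    exact Finset.sum_congr rfl fun j _ => mul_comm _ _
  have hT0 : (fun (i : Fin A) (j : Fin p) => (T i).coeff j) = 0 := by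
    apply hindS
    rw [← h]
    refine Finset.sum_congr rfl fun i _ => ?_
    simp only [mul_assoc, ← Finset.mul_sum]
    rw [← hTU, eval₂_eq_sum_range' _ (hTdeg i), Finset.sum_range]
    simp only [hφ, mul_comm]
  have hT1 : ∀ i, T i = 0 := by
    intro i
    ext j
    by_cases hj : j < p
    · exact congrFun (congrFun hT0 i) ⟨j, hj⟩
    · rw [coeff_eq_zero_of_natDegree_lt ((hTdeg i).trans_le (not_lt.mp hj)), coeff_zero]
  ext i j
  have h1 : U i = (T i).comp (C y - X) := by
    simp only [T, comp_assoc]; simp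
  have h2 : (U i).coeff j = u i j := by
    simp [U, finsetSum_coeff, coeff_X_pow, Fin.val_inj]
  rw [← h2, h1, hT1]; simp

/-- `T ∈ R[x][y]` has weight at most `n` when `x` has weight `1` and `y` has weight `δ`. -/
def Polynomial.WeightLE {R : Type*} [CommRing R] (δ n : ℕ) (T : R[X][X]) : Prop :=
  ∀ j s, n < s + δ * j → (T.coeff j).coeff s = 0

namespace Polynomial.WeightLE

variable {R : Type*} [CommRing R] {δ m n : ℕ} {S T : R[X][X]}

theorem mono (h : WeightLE δ m T) (hmn : m ≤ n) : WeightLE δ n T :=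
  fun j s hs => h j s (hmn.trans_lt hs)

theorem zero : WeightLE δ n (0 : R[X][X]) := fun _ _ _ => by simp

theorem add (hS : WeightLE δ n S) (hT : WeightLE δ n T) : WeightLE δ n (S + T) :=
  fun j s hs => by simp [hS j s hs, hT j s hs]

theorem sub (hS : WeightLE δ n S) (hT : WeightLE δ n T) : WeightLE δ n (S - T) :=
  fun j s hs => by simp [hS j s hs, hT j s hs]

theorem sum {ι : Type*} {s : Finset ι} {f : ι → R[X][X]} (h : ∀ i ∈ s, WeightLE δ n (f i)) :
    WeightLE δ n (∑ i ∈ s, f i) := by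
  classical
  induction s using Finset.induction_on with
  | empty => simpa using zero
  | insert a s ha ih =>
    rw [Finset.sum_insert ha]
    exact (h _ (by simp)).add (ih fun i hi => h i (by simp [hi]))

theorem mul (hS : WeightLE δ m S) (hT : WeightLE δ n T) : WeightLE δ (m + n) (S * T) := by
  intro j s hs
  rw [coeff_mul, finsetSum_coeff]
  refine Finset.sum_eq_zero fun x hx => ?_
  rw [coeff_mul]
  refine Finset.sum_eq_zero fun z hz => ?_
  simp only [Finset.HasAntidiagonal.mem_antidiagonal] at hx hz
  by_cases h1 : m < z.1 + δ * x.1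
  · rw [hS _ _ h1, zero_mul]
  · rw [hT x.2 z.2, mul_zero]
    rw [← hx, ← hz, mul_add] at hs
    omega

theorem C {h : R[X]} (hh : h.natDegree ≤ n) : WeightLE δ n (C h) := by
  intro j s hs
  rw [coeff_C]
  split_ifs with hj
  · subst hj
    exact coeff_eq_zero_of_natDegree_lt (by omega)
  · simp

theorem one : WeightLE δ 0 (1 : R[X][X]) := by
  rw [← map_one Polynomial.C]; exact WeightLE.C (by simp)

theorem X : WeightLE δ δ (X : R[X][X]) := by
  intro j s hs
  rw [coeff_X]
  split_ifs with hj
  · subst hj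
    rw [coeff_one, if_neg (by omega)]
  · simp

theorem pow (hT : WeightLE δ n T) (k : ℕ) : WeightLE δ (k * n) (T ^ k) := by
  induction k with
  | zero => simpa using one
  | succ k ih => rw [pow_succ, add_mul, one_mul]; exact ih.mul hT

theorem modByMonic [Nontrivial R] {f : R[X][X]} (hf : f.Monic) (hfw : WeightLE δ (f.natDegree * δ) f)
    (hT : WeightLE δ n T) : WeightLE δ n (T %ₘ f) := by
  induction hk : T.natDegree using Nat.strong_induction_on generalizing T with
  | _ k ih =>
  by_cases hlt : T.degree < f.degree
  · rwa [(modByMonic_eq_self_iff hf).mpr hlt]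
  have hle : f.degree ≤ T.degree := not_lt.mp hlt
  have hT0 : T ≠ 0 := by
    rintro rfl; simp [hf.ne_zero] at hle
  have hnat : f.natDegree ≤ T.natDegree := natDegree_le_natDegree hle
  have hlt' := degree_sub_lt_left (p := T) (q := f * (Polynomial.C T.leadingCoeff * Polynomial.X ^ (T.natDegree - f.natDegree)))
    (by
      rw [hf.degree_mul_comm, hf.degree_mul, degree_C_mul_X_pow _ (leadingCoeff_ne_zero.mpr hT0),
        degree_eq_natDegree hT0, degree_eq_natDegree hf.ne_zero, ← Nat.cast_add,
        Nat.sub_add_cancel hnat]) hT0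
    (by rw [leadingCoeff_monic_mul hf, leadingCoeff_mul_X_pow, leadingCoeff_C])
  set g := Polynomial.C T.leadingCoeff * Polynomial.X ^ (T.natDegree - f.natDegree) with hg
  have hmod : T %ₘ f = (T - f * g) %ₘ f := by
    rw [sub_modByMonic, (modByMonic_eq_zero_iff_dvd hf).mpr (dvd_mul_right f g), sub_zero]
  have hTn : f.natDegree * δ ≤ n := by
    by_contra hcon
    apply hT0
    rw [← leadingCoeff_eq_zero]
    ext s
    rw [leadingCoeff, hT, coeff_zero]
    have := Nat.mul_le_mul_left δ hnat
    rw [mul_comm] at hcon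
    omega
  have hgw : WeightLE δ (n - f.natDegree * δ) g := by
    intro j s hs
    rw [hg, coeff_C_mul_X_pow]
    split_ifs with hj
    · apply hT
      subst hj
      have := Nat.mul_sub δ T.natDegree f.natDegree
      have h2 := Nat.mul_le_mul_left δ hnat
      rw [mul_comm f.natDegree] at hs
      omega
    · simp
  have hw : WeightLE δ n (T - f * g) := by
    refine hT.sub ?_
    have := hfw.mul hgw
    rwa [Nat.add_sub_cancel' hTn] at this
  rw [hmod]
  by_cases h0 : T - f * g = 0
  · rw [h0, zero_modByMonic]; exact zero
  · exact ih _ (hk ▸ natDegree_lt_natDegree h0 hlt') hw rfl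

theorem natDegree_coeff_le (hT : WeightLE δ n T) (j : ℕ) : (T.coeff j).natDegree ≤ n := by
  rw [natDegree_le_iff_coeff_eq_zero]
  intro s hs
  exact hT _ _ (by omega)

end Polynomial.WeightLE

/-- The polynomial satisfied by `E * y`, where `y ^ p - y = N / E`. -/
noncomputable def integralArtinSchreierPoly {R : Type*} [CommRing R] (p : ℕ) (N E : R) : R[X] :=
  X ^ p - (C (E ^ (p - 1)) * X + C (N * E ^ (p - 1)))

theorem integralArtinSchreierPoly_aux {R : Type*} [CommRing R] [Nontrivial R] {p : ℕ} (hp : 1 < p)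
    (N E : R) : (C (E ^ (p - 1)) * X + C (N * E ^ (p - 1)) : R[X]).degree < p := by
  refine degree_linear_le.trans_lt ?_
  exact_mod_cast hp

theorem integralArtinSchreierPoly_monic {R : Type*} [CommRing R] [Nontrivial R] {p : ℕ}
    (hp : 1 < p) (N E : R) : (integralArtinSchreierPoly p N E).Monic :=
  monic_X_pow_sub (integralArtinSchreierPoly_aux hp N E)

theorem integralArtinSchreierPoly_natDegree {R : Type*} [CommRing R] [Nontrivial R] {p : ℕ}
    (hp : 1 < p) (N E : R) : (integralArtinSchreierPoly p N E).natDegree = p := by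
  apply natDegree_eq_of_degree_eq_some
  rw [integralArtinSchreierPoly, degree_sub_eq_left_of_degree_lt, degree_X_pow]
  rw [degree_X_pow]
  exact integralArtinSchreierPoly_aux hp N E

theorem eval₂_integralArtinSchreierPoly {R S : Type*} [CommRing R] [CommRing S] {p : ℕ}
    (hp : 1 < p) (φ : R →+* S) {N E : R} {y D : S} (hy : y ^ p = y + D) (hD : φ E * D = φ N) :
    (integralArtinSchreierPoly p N E).eval₂ φ (φ E * y) = 0 := by
  obtain ⟨p, rfl⟩ := Nat.exists_eq_add_of_lt hp
  simp only [integralArtinSchreierPoly, eval₂_sub, eval₂_X_pow, eval₂_add, eval₂_mul, eval₂_C,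
    eval₂_X]
  simp only [map_mul, map_pow, mul_pow, hy, ← hD]
  rw [show 1 + p + 1 - 1 = p + 1 by omega, show 1 + p + 1 = (p + 1) + 1 by omega]
  ring

/-- The numerator over `E ^ p ^ n` of `∑ i < n, (N / E) ^ p ^ i`. -/
def partialTraceNum {R : Type*} [CommRing R] (p n : ℕ) (N E : R) : R :=
  ∑ i ∈ Finset.range n, N ^ p ^ i * E ^ (p ^ n - p ^ i)

theorem mul_pow_prime_pow_eq {R S : Type*} [CommRing R] [CommRing S] {p : ℕ} [Fact p.Prime]
    [CharP S p] (φ : R →+* S) {N E : R} {y D : S} (hy : y ^ p = y + D) (hD : φ E * D = φ N)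
    (n : ℕ) :
    (φ E * y) ^ p ^ n = φ (E ^ (p ^ n - 1)) * (φ E * y) + φ (partialTraceNum p n N E) := by
  have hp : p.Prime := Fact.out
  rw [mul_pow, pow_prime_pow_eq_add_sum hy, mul_add, Finset.mul_sum, partialTraceNum, map_sum,
    ← mul_assoc, map_pow, ← pow_succ, Nat.sub_add_cancel (Nat.one_le_pow _ _ hp.pos)]
  congr 1
  refine Finset.sum_congr rfl fun i hi => ?_
  have : p ^ i ≤ p ^ n := Nat.pow_le_pow_right hp.pos (Finset.mem_range.mp hi).le
  rw [map_mul, map_pow, map_pow, ← hD, mul_pow]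
  conv_lhs => rw [← Nat.sub_add_cancel this, pow_add]
  ring

theorem natDegree_partialTraceNum_le {R : Type*} [CommRing R] {p : ℕ} (hp : p.Prime) {N E : R[X]}
    {δ : ℕ} (hN : N.natDegree ≤ δ) (hE : E.natDegree ≤ δ) (n : ℕ) :
    (partialTraceNum p n N E).natDegree ≤ p ^ n * δ := by
  refine natDegree_sum_le_of_forall_le _ _ fun i hi => ?_
  have : p ^ i ≤ p ^ n := Nat.pow_le_pow_right hp.pos (Finset.mem_range.mp hi).le
  calc _ ≤ p ^ i * δ + (p ^ n - p ^ i) * δ :=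
        natDegree_mul_le_of_le (natDegree_pow_le_of_le _ hN) (natDegree_pow_le_of_le _ hE)
    _ = _ := by rw [← add_mul, Nat.add_sub_cancel' this]

namespace Polynomial.WeightLE

variable {R : Type*} [CommRing R] {δ : ℕ} {N E : R[X]}

theorem integralArtinSchreierPoly {p : ℕ} (hp : 1 < p) (hN : N.natDegree ≤ δ)
    (hE : E.natDegree ≤ δ) : WeightLE δ (p * δ) (integralArtinSchreierPoly p N E) := by
  have hE' : (E ^ (p - 1)).natDegree ≤ (p - 1) * δ := natDegree_pow_le_of_le _ hE
  have h : (p - 1) * δ + δ = p * δ := by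
    rw [← Nat.succ_mul, Nat.succ_eq_add_one, Nat.sub_add_cancel hp.le]
  refine (X.pow p).sub (WeightLE.add ?_ (WeightLE.C ?_))
  · rw [← h]
    exact (WeightLE.C hE').mul X
  · rw [← h, add_comm]
    exact natDegree_mul_le_of_le hN hE'

theorem frobenius_aux {p : ℕ} (hp : p.Prime) (hN : N.natDegree ≤ δ) (hE : E.natDegree ≤ δ)
    (n : ℕ) : WeightLE δ (p ^ n * δ)
      (Polynomial.C (E ^ (p ^ n - 1)) * Polynomial.X + Polynomial.C (partialTraceNum p n N E)) := by
  refine WeightLE.add ?_ (WeightLE.C (natDegree_partialTraceNum_le hp hN hE n))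
  have h : (p ^ n - 1) * δ + δ = p ^ n * δ := by
    rw [← Nat.succ_mul, Nat.succ_eq_add_one, Nat.sub_add_cancel (Nat.one_le_pow _ _ hp.pos)]
  rw [← h]
  exact (WeightLE.C (natDegree_pow_le_of_le _ hE)).mul X

end Polynomial.WeightLE

theorem Polynomial.exists_ne_zero_sum_modByMonic_eq_zero {L ι : Type*} [Field L] [Fintype ι]
    {δ n : ℕ} {F : L[X][X]} (hF : F.Monic) (hFw : WeightLE δ (F.natDegree * δ) F)
    {W : ι → L[X][X]} (hW : ∀ i, WeightLE δ n (W i))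
    (hcard : F.natDegree * (n + 1) < Fintype.card ι) :
    ∃ c : ι → L, c ≠ 0 ∧ (∑ i, C (C (c i)) * W i) %ₘ F = 0 := by
  let coeffs : (ι → L) →ₗ[L] (Fin F.natDegree → Fin (n + 1) → L) :=
    { toFun := fun c j s => (((∑ i, C (C (c i)) * W i) %ₘ F).coeff j).coeff s
      map_add' := by
        intro c c'
        ext j s
        simp [add_mul, Finset.sum_add_distrib, add_modByMonic]
      map_smul' := by
        intro a c
        ext j s
        have : ∑ i, C (C ((a • c) i)) * W i = (C a : L[X]) • ∑ i, C (C (c i)) * W i := by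
          simp [Finset.smul_sum, smul_eq_C_mul, mul_assoc]
        rw [this, smul_modByMonic]
        simp }
  have hker : LinearMap.ker coeffs ≠ ⊥ := by
    apply LinearMap.ker_ne_bot_of_finrank_lt
    simpa [Module.finrank_pi_fintype] using hcard
  obtain ⟨c, hc, hc0⟩ := Submodule.exists_mem_ne_zero_of_ne_bot hker
  refine ⟨c, hc0, ?_⟩
  have hw : WeightLE δ n ((∑ i, C (C (c i)) * W i) %ₘ F) := by
    refine WeightLE.modByMonic hF hFw (WeightLE.sum fun i _ => ?_)
    have := (WeightLE.C (δ := δ) (n := 0) (h := (C (c i) : L[X])) (by simp)).mul (hW i)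
    rwa [zero_add] at this
  ext j s
  rw [coeff_zero, coeff_zero]
  by_cases hj : j < F.natDegree
  · by_cases hs : s < n + 1
    · exact congrFun (congrFun (LinearMap.mem_ker.mp hc) ⟨j, hj⟩) ⟨s, hs⟩
    · exact hw _ _ (by omega)
  · have : ((∑ i, C (C (c i)) * W i) %ₘ F).coeff j = 0 := by
      refine coeff_eq_zero_of_degree_lt ((degree_modByMonic_lt _ hF).trans_le ?_)
      rw [degree_eq_natDegree hF.ne_zero]
      exact_mod_cast not_lt.mp hj
    rw [this, coeff_zero]

/-- If `T` vanishes on all points of the curve `y ^ p = y + N / E` above `x₀`, then the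
reduction of `T` vanishes identically above `x₀`. -/
theorem eval_coeff_modByMonic_eq_zero {L : Type*} [Field L] {p : ℕ} [Fact p.Prime] [CharP L p]
    {N E : L[X]} {x₀ y₀ : L} (hE : E.eval x₀ ≠ 0)
    (hy : y₀ ^ p = y₀ + N.eval x₀ / E.eval x₀) {T : L[X][X]}
    (hT : ∀ k : L, k ^ p = k → T.eval₂ (evalRingHom x₀) (E.eval x₀ * (y₀ + k)) = 0) (j : ℕ) :
    ((T %ₘ integralArtinSchreierPoly p N E).coeff j).eval x₀ = 0 := by
  have hp : p.Prime := Fact.out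
  set F := integralArtinSchreierPoly p N E with hFdef
  have hF : F.Monic := integralArtinSchreierPoly_monic hp.one_lt _ _
  have h0 : (T %ₘ F).map (evalRingHom x₀) = 0 := by
    refine eq_zero_of_natDegree_lt_card_of_eval_eq_zero (ι := ZMod p) _
      (f := fun k => E.eval x₀ * (y₀ + ZMod.castHom dvd_rfl L k)) ?_ ?_ ?_
    · intro k k' h
      exact (ZMod.castHom dvd_rfl L).injective (add_left_cancel (mul_left_cancel₀ hE h))
    · intro k
      have hk : (ZMod.castHom dvd_rfl L k) ^ p = ZMod.castHom dvd_rfl L k := by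
        rw [← map_pow, ZMod.pow_card]
      have h1 := hT _ hk
      rw [← modByMonic_add_div T F, eval₂_add, eval₂_mul] at h1
      have h2 := eval₂_integralArtinSchreierPoly hp.one_lt (evalRingHom x₀) (N := N) (E := E)
        (y := y₀ + ZMod.castHom dvd_rfl L k) (D := N.eval x₀ / E.eval x₀)
        (by rw [add_pow_char, hy, hk]; ring)
        (by simp only [coe_evalRingHom]; field_simp)
      simp only [coe_evalRingHom] at h2
      rw [← hFdef] at h2
      rw [h2, zero_mul, add_zero] at h1
      rw [eval_map]
      exact h1
    · rw [ZMod.card]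
      refine natDegree_map_le.trans_lt ?_
      have := natDegree_modByMonic_lt T hF (q := F) (by
        intro h
        have h2 := integralArtinSchreierPoly_natDegree hp.one_lt N E
        rw [← hFdef, h, natDegree_one] at h2
        exact hp.ne_zero h2.symm)
      rwa [hFdef, integralArtinSchreierPoly_natDegree hp.one_lt] at this
  have := congrArg (fun P => P.coeff j) h0
  simpa [coeff_map] using this

/-- The monomials from which the auxiliary polynomials of Stepanov's method are built. -/
noncomputable def stepanovTerm {L : Type*} [CommRing L] {A B p : ℕ} (E σ : L[X]) (r r' : ℕ)
    (Y Y' : L[X][X]) (t : Fin A × Fin p × Fin B × Fin p) : L[X][X] :=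
  C (σ ^ (r * t.1) * E ^ (r * (p - 1 - t.2.1)) * X ^ (r' * t.2.2.1)) * Y ^ (t.2.1 : ℕ) *
    Y' ^ (t.2.2.2 : ℕ)

theorem Polynomial.WeightLE.stepanovTerm {L : Type*} [CommRing L] {A B p δ : ℕ} {E σ : L[X]}
    (hE : E.natDegree ≤ δ) (hσ : σ.natDegree ≤ 1) {r r' : ℕ} {Y Y' : L[X][X]}
    (hY : WeightLE δ (r * δ) Y) (hY' : WeightLE δ (r' * δ) Y')
    (t : Fin A × Fin p × Fin B × Fin p) :
    WeightLE δ (r * A + r' * B + δ * (p - 1) * (r + r')) (stepanovTerm E σ r r' Y Y' t) := by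
  obtain ⟨i, j, i', j'⟩ := t
  have h1 : (σ ^ (r * i) * E ^ (r * (p - 1 - j)) * (Polynomial.X : L[X]) ^ (r' * i')).natDegree ≤
      r * i * 1 + r * (p - 1 - j) * δ + r' * i' :=
    natDegree_mul_le_of_le (natDegree_mul_le_of_le (natDegree_pow_le_of_le _ hσ)
      (natDegree_pow_le_of_le _ hE)) (natDegree_X_pow_le _)
  refine (((WeightLE.C h1).mul (hY.pow j)).mul (hY'.pow j')).mono ?_
  have e1 : r * i ≤ r * A := Nat.mul_le_mul_left _ i.2.le
  have e2 : r' * i' ≤ r' * B := Nat.mul_le_mul_left _ i'.2.le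
  have e3 : (j' : ℕ) * (r' * δ) ≤ (p - 1) * (r' * δ) :=
    Nat.mul_le_mul_right _ (Nat.le_sub_one_of_lt j'.2)
  have e4 : r * (p - 1 - j) * δ + j * (r * δ) = (p - 1) * (r * δ) := by
    have : p - 1 - j + j = p - 1 := Nat.sub_add_cancel (Nat.le_sub_one_of_lt j.2)
    calc _ = (p - 1 - j + j) * (r * δ) := by ring
      _ = _ := by rw [this]
  calc _ = r * i + r' * i' + (r * (p - 1 - j) * δ + j * (r * δ)) + j' * (r' * δ) := by ring
    _ ≤ r * A + r' * B + (p - 1) * (r * δ) + (p - 1) * (r' * δ) := by rw [e4]; gcongr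
    _ = _ := by ring

theorem eval₂_stepanovTerm {L S : Type*} [CommRing L] [CommRing S] {A B p : ℕ} (φ : L[X] →+* S)
    (z : S) (E σ : L[X]) (r r' : ℕ) (Y Y' : L[X][X]) (t : Fin A × Fin p × Fin B × Fin p) :
    (stepanovTerm E σ r r' Y Y' t).eval₂ φ z =
      φ σ ^ (r * t.1) * φ E ^ (r * (p - 1 - t.2.1)) * φ X ^ (r' * t.2.2.1) *
        Y.eval₂ φ z ^ (t.2.1 : ℕ) * Y'.eval₂ φ z ^ (t.2.2.2 : ℕ) := by
  simp only [stepanovTerm, eval₂_mul, eval₂_C, eval₂_pow, map_mul, map_pow]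

theorem integralArtinSchreierPoly_not_dvd_sum_stepanovTerm {L : Type*} [Field L] {p : ℕ}
    [Fact p.Prime] [CharP L p] {N E : L[X]} (hE : E ≠ 0) {s : L} {n A B : ℕ}
    (hind : ∀ c : Fin A → Fin p → RatFunc L, ∑ i : Fin A, ∑ j : Fin p,
      algebraMap L[X] (RatFunc L) (X - C s) ^ (i : ℕ) *
      (∑ k ∈ Finset.range n, (algebraMap L[X] (RatFunc L) N / algebraMap L[X] (RatFunc L) E) ^ p ^ k)
        ^ (j : ℕ) * c i j ^ p ^ n = 0 → c = 0)
    (β : Fin A × Fin p × Fin B × Fin p → L)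
    (h : integralArtinSchreierPoly p N E ∣ ∑ t, C (C (β t ^ p ^ n)) *
      stepanovTerm E (X - C s) 1 (p ^ n) X
        (C (E ^ (p ^ n - 1)) * X + C (partialTraceNum p n N E)) t) : β = 0 := by
  have hp : p.Prime := Fact.out
  have : CharP (RatFunc L) p := charP_of_injective_algebraMap (algebraMap L (RatFunc L)).injective p
  set D : RatFunc L := algebraMap L[X] (RatFunc L) N / algebraMap L[X] (RatFunc L) E with hD
  set f := artinSchreierPoly p D with hf
  have hfm : f.Monic := artinSchreierPoly_monic hp.one_lt _
  have hfd : f.natDegree = p := artinSchreierPoly_natDegree hp.one_lt _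
  have : Nontrivial (AdjoinRoot f) := AdjoinRoot.nontrivial _ (by
    rw [degree_eq_natDegree hfm.ne_zero, hfd]; exact_mod_cast hp.ne_zero)
  have : CharP (AdjoinRoot f) p := charP_of_injective_ringHom (AdjoinRoot.of f).injective p
  have hE' : algebraMap L[X] (RatFunc L) E ≠ 0 := by
    simpa using hE
  set φ : L[X] →+* AdjoinRoot f := (AdjoinRoot.of f).comp (algebraMap L[X] (RatFunc L)) with hφ
  have hφE : IsUnit (φ E) := (IsUnit.mk0 _ hE').map (AdjoinRoot.of f)
  have hy : AdjoinRoot.root f ^ p = AdjoinRoot.root f + AdjoinRoot.of f D := by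
    have := AdjoinRoot.eval₂_root f
    conv at this => lhs; arg 3; rw [hf, artinSchreierPoly]
    simp only [eval₂_sub, eval₂_X_pow, eval₂_X, eval₂_C] at this
    linear_combination this
  have hφD : φ E * AdjoinRoot.of f D = φ N := by
    rw [hφ, RingHom.comp_apply, ← map_mul, hD, mul_div_cancel₀ _ hE']; rfl
  have hev := eval₂_integralArtinSchreierPoly hp.one_lt φ hy hφD
  have h0 := eval₂_eq_zero_of_dvd_of_eval₂_eq_zero φ _ h hev
  rw [eval₂_finsetSum] at h0
  have hFr : (C (E ^ (p ^ n - 1)) * X + C (partialTraceNum p n N E)).eval₂ φ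
      (φ E * AdjoinRoot.root f) = (φ E * AdjoinRoot.root f) ^ p ^ n := by
    rw [mul_pow_prime_pow_eq φ hy hφD n]
    simp only [eval₂_add, eval₂_mul, eval₂_C, eval₂_X]
  let T : Fin A → Fin p → (RatFunc L)[X] := fun i j => ∑ j' : Fin p,
    C (algebraMap L[X] (RatFunc L) ((∑ i' : Fin B, C (β (i, j, i', j')) * X ^ (i' : ℕ)) *
      E ^ (j' : ℕ))) * X ^ (j' : ℕ)
  have hT : (fun i j => AdjoinRoot.mk f (T i j)) = 0 := by
    refine AdjoinRoot.eq_zero_of_sum_mul_root_pow_mul_pow (τ := algebraMap L[X] (RatFunc L) (X - C s))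
      hf hind _ ?_
    apply (hφE.pow (p - 1)).mul_left_cancel
    rw [mul_zero, ← h0]
    simp only [eval₂_mul, eval₂_stepanovTerm, eval₂_C, hFr, eval₂_X, Fintype.sum_prod_type,
      Finset.mul_sum]
    refine Finset.sum_congr rfl fun i _ => Finset.sum_congr rfl fun j _ => ?_
    rw [Finset.sum_comm]
    simp only [T, map_sum, sum_pow_char_pow, Finset.mul_sum, Finset.sum_mul]
    refine Finset.sum_congr rfl fun j' _ => Finset.sum_congr rfl fun i' _ => ?_
    rw [← pow_sub_mul_pow (φ E) (Nat.le_sub_one_of_lt j.2)]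
    simp only [map_mul, map_pow, AdjoinRoot.mk_C, AdjoinRoot.mk_X, hφ, RingHom.comp_apply, mul_pow,
      one_mul]
    ring
  funext ⟨i, j, i', j'⟩
  have h1 : AdjoinRoot.mk f (T i j) = 0 := congrFun (congrFun hT i) j
  have h2 : T i j = 0 := by
    refine eq_zero_of_dvd_of_degree_lt (AdjoinRoot.mk_eq_zero.mp h1) ?_
    rw [degree_eq_natDegree hfm.ne_zero, hfd]
    refine (degree_sum_le _ _).trans_lt ((Finset.sup_lt_iff (by simp)).mpr fun j' _ => ?_)
    refine (degree_C_mul_X_pow_le _ _).trans_lt ?_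
    exact_mod_cast j'.2
  have h3 := congrArg (fun P => P.coeff j') h2
  simp only [T, finsetSum_coeff, coeff_C_mul_X_pow, coeff_zero, Fin.val_inj, Finset.sum_ite_eq,
    Finset.mem_univ, if_true] at h3
  have h4 : (∑ i' : Fin B, C (β (i, j, i', j')) * X ^ (i' : ℕ)) = 0 := by
    rw [map_eq_zero_iff _ (RatFunc.algebraMap_injective L)] at h3
    exact (mul_eq_zero.mp h3).resolve_right (pow_ne_zero _ hE)
  have h5 := congrArg (fun P => P.coeff i') h4
  simpa [finsetSum_coeff, coeff_C_mul_X_pow, Fin.val_inj] using h5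

open WithZero in
/-- Stepanov's bound for the number of rational points of `y ^ p - y = N / E` lying in a
given twist. -/
theorem stepanov_card_le {L : Type*} [Field L] [IsAlgClosed L] {p : ℕ} [Fact p.Prime] [CharP L p]
    {N E : L[X]} (hE : E ≠ 0) {δ : ℕ} (hNδ : N.natDegree ≤ δ) (hEδ : E.natDegree ≤ δ) {s : L}
    {v : Valuation (RatFunc L) ℤᵐ⁰} {ε d : ℤ} (hε : ε = 1 ∨ ε = -1)
    (hs : v (algebraMap L[X] (RatFunc L) (X - C s)) = exp ε) (hd : 0 < d) (hpd : ¬ (p : ℤ) ∣ d)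
    (hv : v (algebraMap L[X] (RatFunc L) N / algebraMap L[X] (RatFunc L) E) = exp d)
    {a : L} {n m B : ℕ}
    (hcard : p * (p ^ n * p ^ m + B + δ * (p - 1) * (p ^ n + 1) + 1) < p ^ 2 * p ^ m * B)
    (Z : Finset L) (hZx : ∀ x ∈ Z, x ^ p ^ (n + m + 1) = x) (hZE : ∀ x ∈ Z, E.eval x ≠ 0)
    (hZE' : ∀ x ∈ Z, E.eval x ^ p ^ (n + m + 1) = E.eval x)
    (hZ : ∀ x ∈ Z, ∑ i ∈ Finset.range (n + m + 1), (N.eval x / E.eval x) ^ p ^ i = a) :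
    Z.card ≤ p ^ m + p ^ (m + 1) * B + δ * (p - 1) * (1 + p ^ (m + 1)) := by
  have hp : p.Prime := Fact.out
  set F := integralArtinSchreierPoly p N E with hFdef
  have hF : F.Monic := integralArtinSchreierPoly_monic hp.one_lt _ _
  have hFd : F.natDegree = p := integralArtinSchreierPoly_natDegree hp.one_lt _ _
  have hFw : WeightLE δ (F.natDegree * δ) F := by
    rw [hFd]; exact WeightLE.integralArtinSchreierPoly hp.one_lt hNδ hEδ
  have hσ : (X - C s : L[X]).natDegree ≤ 1 := natDegree_X_sub_C_le s
  obtain ⟨c, hc0, hc⟩ := exists_ne_zero_sum_modByMonic_eq_zero hF hFw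
    (W := stepanovTerm (A := p ^ m) (B := B) (p := p) E (X - C s) (p ^ n) 1
      (C (E ^ (p ^ n - 1)) * X + C (partialTraceNum p n N E)) (X + C (C a * E)))
    (fun t => WeightLE.stepanovTerm hEδ hσ (WeightLE.frobenius_aux hp hNδ hEδ n)
      (WeightLE.add (by simpa using WeightLE.X) (WeightLE.C (by
        rw [one_mul]; exact (natDegree_C_mul_le _ _).trans hEδ))) t)
    (by
      rw [hFd]
      simp only [Fintype.card_prod, Fintype.card_fin]
      calc _ = _ := by rw [one_mul]
        _ < _ := hcard
        _ = _ := by ring)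
  choose β hβ using fun t => IsAlgClosed.exists_pow_nat_eq (c t) (n := p ^ (n + m + 1))
    (pow_pos hp.pos _)
  have hβ0 : β ≠ 0 := by
    rintro rfl
    apply hc0
    funext t
    rw [← hβ t, Pi.zero_apply, zero_pow (pow_pos hp.pos _).ne']
  set Ψ : L[X][X] := ∑ t, C (C (β t ^ p ^ (m + 1))) *
    stepanovTerm E (X - C s) 1 (p ^ (m + 1)) X
      (C (E ^ (p ^ (m + 1) - 1)) * X + C (partialTraceNum p (m + 1) N E)) t with hΨ
  have hndvd : ¬ F ∣ Ψ := fun h => hβ0 <|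
    integralArtinSchreierPoly_not_dvd_sum_stepanovTerm hE
      (Valuation.coeff_eq_zero_of_sum_pow_mul_pow hp v hε hs
        (Valuation.map_sum_pow_prime_pow hp v hd hv m) hpd) β h
  have hR0 : Ψ %ₘ F ≠ 0 := fun h => hndvd ((modByMonic_eq_zero_iff_dvd hF).mp h)
  obtain ⟨j, hj⟩ : ∃ j, (Ψ %ₘ F).coeff j ≠ 0 := by
    by_contra! h
    exact hR0 (ext h)
  have hdeg : ((Ψ %ₘ F).coeff j).natDegree ≤
      p ^ m + p ^ (m + 1) * B + δ * (p - 1) * (1 + p ^ (m + 1)) := by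
    refine (WeightLE.modByMonic hF hFw (WeightLE.sum fun t _ => ?_)).natDegree_coeff_le j
    have h1 := (WeightLE.C (δ := δ) (n := 0) (h := (C (β t ^ p ^ (m + 1)) : L[X])) (by simp)).mul
      (WeightLE.stepanovTerm hEδ hσ (r := 1) (by simpa using WeightLE.X)
        (WeightLE.frobenius_aux hp hNδ hEδ (m + 1)) t)
    rwa [zero_add, one_mul] at h1
  have hzero : ∀ x ∈ Z, ((Ψ %ₘ F).coeff j).eval x = 0 := by
    intro x hx
    obtain ⟨y, hy⟩ : ∃ y : L, y ^ p = y + N.eval x / E.eval x := by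
      obtain ⟨y, hy⟩ := IsAlgClosed.exists_root (artinSchreierPoly p (N.eval x / E.eval x)) (by
        rw [degree_eq_natDegree (artinSchreierPoly_monic hp.one_lt _).ne_zero,
          artinSchreierPoly_natDegree hp.one_lt]
        exact_mod_cast hp.ne_zero)
      refine ⟨y, ?_⟩
      simp only [artinSchreierPoly, IsRoot.def, eval_sub, eval_pow, eval_X, eval_C] at hy
      linear_combination hy
    refine eval_coeff_modByMonic_eq_zero (hZE x hx) hy (fun k hk => ?_) j
    have hy' : (y + k) ^ p = (y + k) + N.eval x / E.eval x := by
      rw [add_pow_char, hy, hk]; ring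
    generalize y + k = y at hy'
    have hD : (evalRingHom x) E * (N.eval x / E.eval x) = evalRingHom x N :=
      mul_div_cancel₀ _ (hZE x hx)
    have hyQ : y ^ p ^ (n + m + 1) = y + a := by
      rw [pow_prime_pow_eq_add_sum hy', hZ x hx]
    have hFr : ∀ n, (C (E ^ (p ^ n - 1)) * X + C (partialTraceNum p n N E)).eval₂ (evalRingHom x)
        (E.eval x * y) = (E.eval x * y) ^ p ^ n := by
      intro n
      have := mul_pow_prime_pow_eq (evalRingHom x) hy' hD n
      simp only [coe_evalRingHom] at this
      rw [this]
      simp only [eval₂_add, eval₂_mul, eval₂_C, eval₂_X, coe_evalRingHom]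
    have h0 := eval₂_eq_zero_of_dvd_of_eval₂_eq_zero (evalRingHom x) _
      ((modByMonic_eq_zero_iff_dvd hF).mp hc)
      (eval₂_integralArtinSchreierPoly hp.one_lt (evalRingHom x) hy' hD)
    have hpow : (Ψ.eval₂ (evalRingHom x) (E.eval x * y)) ^ p ^ n = 0 := by
      rw [← h0, hΨ, eval₂_finsetSum, eval₂_finsetSum, sum_pow_char_pow]
      refine Finset.sum_congr rfl fun t _ => ?_
      have hY' : (X + C (C a * E)).eval₂ (evalRingHom x) (E.eval x * y) =
          (E.eval x * y) ^ p ^ (n + m + 1) := by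
        rw [mul_pow, hyQ, hZE' x hx]
        simp only [eval₂_add, eval₂_X, eval₂_C, coe_evalRingHom, eval_mul, eval_C]
        ring
      simp only [coe_evalRingHom, eval₂_mul, eval₂_stepanovTerm, eval₂_C, hFr, hY', eval₂_X]
      simp only [eval_X, eval_C, mul_pow, ← hβ t, one_mul, ← pow_mul]
      rw [show x ^ (t.2.2.1 : ℕ) = x ^ (p ^ (n + m + 1) * t.2.2.1) by rw [pow_mul, hZx x hx]]
      ring
    exact eq_zero_of_pow_eq_zero hpow
  refine le_trans ?_ hdeg
  by_contra! hlt
  exact hj (eq_zero_of_natDegree_lt_card_of_eval_eq_zero' _ Z hzero hlt)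

open WithZero in
/-- Stepanov's bound with the parameters optimized. -/
theorem stepanov_card_le_pow {L : Type*} [Field L] [IsAlgClosed L] {p : ℕ} [Fact p.Prime]
    [CharP L p] {N E : L[X]} (hE : E ≠ 0) {δ : ℕ} (hNδ : N.natDegree ≤ δ) (hEδ : E.natDegree ≤ δ)
    {s : L} {v : Valuation (RatFunc L) ℤᵐ⁰} {ε d : ℤ} (hε : ε = 1 ∨ ε = -1)
    (hs : v (algebraMap L[X] (RatFunc L) (X - C s)) = exp ε) (hd : 0 < d) (hpd : ¬ (p : ℤ) ∣ d)
    (hv : v (algebraMap L[X] (RatFunc L) N / algebraMap L[X] (RatFunc L) E) = exp d)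
    {a : L} {M : ℕ} (hM : 2 ≤ M)
    (Z : Finset L) (hZx : ∀ x ∈ Z, x ^ p ^ M = x) (hZE : ∀ x ∈ Z, E.eval x ≠ 0)
    (hZE' : ∀ x ∈ Z, E.eval x ^ p ^ M = E.eval x)
    (hZ : ∀ x ∈ Z, ∑ i ∈ Finset.range M, (N.eval x / E.eval x) ^ p ^ i = a) :
    Z.card ≤ p ^ (M - 1) + (1 + p * (δ * p ^ 2 + 3) + δ * p ^ 2) * p ^ (M / 2) := by
  have hp : p.Prime := Fact.out
  obtain ⟨m, n, rfl, hn1, hn2, hm⟩ : ∃ m n, M = n + 1 + m + 1 ∧ m ≤ n + 1 ∧ n ≤ m ∧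
      m ≤ M / 2 := ⟨(M - 1) / 2, M - 2 - (M - 1) / 2, by omega, by omega, by omega, by omega⟩
  have hA : 1 ≤ p ^ m := Nat.one_le_pow _ _ hp.pos
  have hRA : p ^ n ≤ p ^ m := Nat.pow_le_pow_right hp.pos hn2
  have hp2 := hp.two_le
  have hδ : δ * (p - 1) * (p + 1) ≤ δ * p ^ 2 := by
    rw [mul_assoc]
    refine Nat.mul_le_mul_left _ ?_
    obtain ⟨k, rfl⟩ := Nat.exists_eq_add_of_le' hp.one_le
    rw [Nat.add_sub_cancel]; nlinarith
  refine (stepanov_card_le hE hNδ hEδ hε hs hd hpd hv (B := p ^ n + (δ * p ^ 2 + 3)) ?_ Z hZx hZE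
    hZE' hZ).trans ?_
  · rw [pow_succ p n]
    generalize p ^ m = A at *
    generalize p ^ n = r at *
    rw [show p ^ 2 * A * (r + (δ * p ^ 2 + 3)) = p * (p * (A * (r + (δ * p ^ 2 + 3)))) by ring]
    refine Nat.mul_lt_mul_of_pos_left ?_ hp.pos
    have h1 : δ * (p - 1) * (r * p + 1) ≤ δ * p ^ 2 * A := by
      calc δ * (p - 1) * (r * p + 1) ≤ δ * (p - 1) * (A * p + A) := by gcongr
        _ = δ * (p - 1) * (p + 1) * A := by ring
        _ ≤ _ := by gcongr
    generalize δ * p ^ 2 = κ at *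
    generalize δ * (p - 1) * (r * p + 1) = Y at *
    have h2 : 2 * (A * (κ + 3)) ≤ p * (A * (κ + 3)) := Nat.mul_le_mul_right _ hp2
    have h3 : κ ≤ A * κ := Nat.le_mul_of_pos_left _ hA
    nlinarith
  · have e : p ^ (n + 1 + m + 1 - 1) = p ^ (m + 1) * p ^ n := by rw [← pow_add]; congr 1; omega
    rw [e]
    have h1 : δ * (p - 1) * (1 + p ^ (m + 1)) ≤ δ * p ^ 2 * p ^ m := by
      calc δ * (p - 1) * (1 + p ^ (m + 1)) ≤ δ * (p - 1) * (p ^ m + p ^ (m + 1)) := by gcongr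
        _ = δ * (p - 1) * (p + 1) * p ^ m := by ring
        _ ≤ _ := by gcongr
    have h2 : p ^ m ≤ p ^ ((n + 1 + m + 1) / 2) := Nat.pow_le_pow_right hp.pos hm
    calc _ ≤ p ^ m + p ^ (m + 1) * (p ^ n + (δ * p ^ 2 + 3)) + δ * p ^ 2 * p ^ m := by gcongr
      _ = p ^ (m + 1) * p ^ n + (1 + p * (δ * p ^ 2 + 3) + δ * p ^ 2) * p ^ m := by ring
      _ ≤ _ := by gcongr

open WithZero

/-- `N / E` has a pole of order prime to `p` at some place of degree one. -/
def HasPrimeToPole {L : Type*} [Field L] (p : ℕ) (N E : L[X]) : Prop :=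
  ∃ (s : L) (v : Valuation (RatFunc L) ℤᵐ⁰) (ε d : ℤ), (ε = 1 ∨ ε = -1) ∧
    v (algebraMap L[X] (RatFunc L) (X - C s)) = exp ε ∧ 0 < d ∧ ¬ (p : ℤ) ∣ d ∧
    v (algebraMap L[X] (RatFunc L) N / algebraMap L[X] (RatFunc L) E) = exp d

theorem hasPrimeToPole_one {L : Type*} [Field L] {p : ℕ} {N : L[X]} (hN : 0 < N.natDegree)
    (hp : ¬ p ∣ N.natDegree) : HasPrimeToPole p N 1 := by
  classical
  refine ⟨0, RatFunc.inftyValuation L, 1, N.natDegree, Or.inl rfl, ?_, by exact_mod_cast hN,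
    by exact_mod_cast hp, ?_⟩
  · rw [C_0, sub_zero, RatFunc.algebraMap_X, RatFunc.inftyValuation.X]
  · rw [map_one, div_one, RatFunc.inftyValuation_apply, RatFunc.inftyValuation.polynomial]
    rintro rfl
    simp at hN

theorem hasPrimeToPole_of_rootMultiplicity {L : Type*} [Field L] {p m : ℕ} {N G : L[X]} {s : L}
    (hN : N.eval s ≠ 0) (hG : G.eval s ≠ 0) (hm : 0 < m) (hp : ¬ p ∣ m) :
    HasPrimeToPole p N ((X - C s) ^ m * G) := by
  let w : IsDedekindDomain.HeightOneSpectrum L[X] :=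
    { asIdeal := Ideal.span {X - C s}
      isPrime := by
        rw [Ideal.span_singleton_prime (X_sub_C_ne_zero s)]; exact prime_X_sub_C s
      ne_bot := by
        rw [ne_eq, Ideal.span_singleton_eq_bot]; exact X_sub_C_ne_zero s }
  have hone : ∀ {g : L[X]}, g.eval s ≠ 0 → w.valuation (RatFunc L) (algebraMap _ _ g) = 1 := by
    intro g hg
    rw [w.valuation_of_algebraMap, IsDedekindDomain.HeightOneSpectrum.intValuation_eq_one_iff,
      Ideal.mem_span_singleton, dvd_iff_isRoot]
    exact hg
  have hX : w.valuation (RatFunc L) (algebraMap _ _ (X - C s)) = exp (-1) := by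
    rw [w.valuation_of_algebraMap, w.intValuation_singleton (X_sub_C_ne_zero s) rfl]
  refine ⟨s, w.valuation (RatFunc L), -1, m, Or.inr rfl, hX, by exact_mod_cast hm,
    by exact_mod_cast hp, ?_⟩
  rw [map_div₀, hone hN, map_mul, map_mul, hone hG, map_pow, map_pow, hX, mul_one, ← exp_nsmul,
    one_div, ← exp_neg]
  simp

/-- Over a perfect field, a pole of order prime to `p` persists after base change. -/
theorem hasPrimeToPole_map {k L : Type*} [Field k] [PerfectField k] [Field L] [IsAlgClosed L]
    [Algebra k L] {p m : ℕ} {N G P : k[X]} (hP : Irreducible P) (hN : ¬ P ∣ N) (hG : ¬ P ∣ G)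
    (hm : 0 < m) (hp : ¬ p ∣ m) :
    HasPrimeToPole p (N.map (algebraMap k L)) ((P ^ m * G).map (algebraMap k L)) := by
  obtain ⟨s, hs⟩ := IsAlgClosed.exists_aeval_eq_zero L P (degree_pos_of_irreducible hP).ne'
  have hev : ∀ {g : k[X]}, ¬ P ∣ g → (g.map (algebraMap k L)).eval s ≠ 0 := by
    intro g hg h0
    obtain ⟨u, w, h⟩ := hP.coprime_iff_not_dvd.mpr hg
    have := congrArg (aeval s) h
    rw [eval_map_algebraMap] at h0
    simp [hs, h0] at this
  obtain ⟨Q, hQ⟩ : X - C s ∣ P.map (algebraMap k L) := by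
    rw [dvd_iff_isRoot, IsRoot.def, eval_map_algebraMap, hs]
  have hQs : Q.eval s ≠ 0 := by
    have hsep := (PerfectField.separable_of_irreducible hP).map (f := algebraMap k L)
    rw [hQ] at hsep
    have h1 := hsep.isCoprime
    obtain ⟨u, w, h⟩ := h1
    intro h0
    have := congrArg (eval s) h
    simp [h0] at this
  rw [Polynomial.map_mul, Polynomial.map_pow, hQ, mul_pow, mul_assoc]
  refine hasPrimeToPole_of_rootMultiplicity (hev hN) ?_ hm hp
  rw [eval_mul, eval_pow]
  exact mul_ne_zero (pow_ne_zero _ hQs) (hev hG)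

theorem exists_pow_prime_eq_of_finite {k : Type*} [Field k] [Finite k] (p : ℕ) [Fact p.Prime]
    [CharP k p] (c : k) : ∃ b : k, b ^ p = c :=
  (Finite.injective_iff_surjective.mp (frobenius_inj k p)) c

/-- Every polynomial is congruent, modulo `F ^ p - F`, to a constant or to a polynomial of degree
prime to `p`. -/
theorem Polynomial.exists_artinSchreier_reduction {k : Type*} [Field k] [Finite k] (p : ℕ)
    [Fact p.Prime] [CharP k p] (f : k[X]) :
    ∃ F g : k[X], f = F ^ p - F + g ∧ (g.natDegree = 0 ∨ ¬ p ∣ g.natDegree) := by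
  have hp : p.Prime := Fact.out
  induction hn : f.natDegree using Nat.strong_induction_on generalizing f with
  | _ n ih =>
  by_cases h0 : f.natDegree = 0 ∨ ¬ p ∣ f.natDegree
  · exact ⟨0, f, by simp [hp.ne_zero], h0⟩
  push Not at h0
  obtain ⟨hd0, m, hm⟩ := h0
  have hm0 : 0 < m := Nat.pos_of_ne_zero (by rintro rfl; simp [hm] at hd0)
  have hmn : m < f.natDegree := by rw [hm]; exact lt_mul_of_one_lt_left hm0 hp.one_lt
  obtain ⟨b, hb⟩ := exists_pow_prime_eq_of_finite p f.leadingCoeff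
  have hlt : (f - (C b * X ^ m) ^ p + C b * X ^ m).natDegree < f.natDegree := by
    have e : (C b * X ^ m) ^ p = C f.leadingCoeff * X ^ f.natDegree := by
      rw [mul_pow, ← C_pow, hb, ← pow_mul, hm, mul_comm m p]
    rw [e, self_sub_C_mul_X_pow]
    have h1 := eraseLead_natDegree_le f
    have h2 := natDegree_C_mul_X_pow_le b m
    have h3 := natDegree_add_le f.eraseLead (C b * X ^ m)
    omega
  obtain ⟨F, g, hFg, hg⟩ := ih _ (hn ▸ hlt) _ rfl
  refine ⟨F + C b * X ^ m, g, ?_, hg⟩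
  rw [add_pow_char]
  linear_combination hFg

/-- Every rational function over a finite field is congruent, modulo `F ^ p - F`, to a constant
or to a function with a pole of order prime to `p`. -/
theorem RatFunc.exists_artinSchreier_reduction {k : Type*} [Field k] [Finite k] (p : ℕ)
    [Fact p.Prime] [CharP k p] (L : Type*) [Field L] [IsAlgClosed L] [Algebra k L]
    (D : RatFunc k) : ∃ F D' : RatFunc k, D = F ^ p - F + D' ∧ ((∃ c, D' = RatFunc.C c) ∨
      HasPrimeToPole p (D'.num.map (algebraMap k L)) (D'.denom.map (algebraMap k L))) := by
  have hp : p.Prime := Fact.out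
  have hchar : CharP (RatFunc k) p :=
    charP_of_injective_algebraMap (algebraMap k (RatFunc k)).injective p
  induction hn : D.denom.natDegree using Nat.strong_induction_on generalizing D with
  | _ n ih =>
  by_cases h1 : D.denom = 1
  · obtain ⟨F, g, hFg, hg⟩ := D.num.exists_artinSchreier_reduction p
    refine ⟨algebraMap _ _ F, algebraMap _ _ g, ?_, ?_⟩
    · rw [← map_pow, ← map_sub, ← map_add, ← hFg]
      conv_lhs => rw [← RatFunc.num_div_denom D, h1, map_one, div_one]
    by_cases hg0 : g.natDegree = 0
    · left
      refine ⟨g.coeff 0, ?_⟩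
      rw [eq_C_of_natDegree_eq_zero hg0]
      simp
    · right
      rw [RatFunc.num_algebraMap, RatFunc.denom_algebraMap, Polynomial.map_one]
      apply hasPrimeToPole_one
      · rw [natDegree_map]; omega
      · rw [natDegree_map]; exact hg.resolve_left hg0
  obtain ⟨P, hP, hPE⟩ := WfDvdMonoid.exists_irreducible_factor (fun h =>
    h1 ((RatFunc.monic_denom D).eq_one_of_isUnit h)) (RatFunc.denom_ne_zero D)
  have hPfin : FiniteMultiplicity P D.denom :=
    FiniteMultiplicity.of_prime_left hP.prime (RatFunc.denom_ne_zero D)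
  obtain ⟨G, hG, hPG⟩ := hPfin.exists_eq_pow_mul_and_not_dvd
  have hPN : ¬ P ∣ D.num := fun h =>
    hP.not_isUnit ((RatFunc.isCoprime_num_denom D).isUnit_of_dvd' h hPE)
  have hm : 0 < multiplicity P D.denom := multiplicity_pos_of_dvd hPE
  generalize multiplicity P D.denom = m at *
  by_cases hpm : p ∣ m
  swap
  · refine ⟨0, D, by simp [hp.ne_zero], Or.inr ?_⟩
    rw [hG]
    exact hasPrimeToPole_map hP hPN hPG hm hpm
  obtain ⟨u, rfl⟩ := hpm
  have hu : 0 < u := pos_of_mul_pos_right hm (Nat.zero_le _)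
  obtain ⟨h, A, hA⟩ : ∃ h A : k[X], D.num - h ^ p * G = P * A := by
    have : Fact (Irreducible P) := ⟨hP⟩
    have hchar' : CharP (AdjoinRoot P) p :=
      charP_of_injective_ringHom (AdjoinRoot.of P).injective p
    have : Module.Finite k (AdjoinRoot P) := (AdjoinRoot.powerBasis hP.ne_zero).finite
    have : Finite (AdjoinRoot P) := Module.finite_of_finite k
    obtain ⟨b, hb⟩ := exists_pow_prime_eq_of_finite p
      (AdjoinRoot.mk P D.num / AdjoinRoot.mk P G)
    obtain ⟨h, rfl⟩ := AdjoinRoot.mk_surjective b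
    refine ⟨h, AdjoinRoot.mk_eq_zero.mp ?_⟩
    have hG0 : AdjoinRoot.mk P G ≠ 0 := by rwa [ne_eq, AdjoinRoot.mk_eq_zero]
    rw [map_sub, map_mul, map_pow, hb, div_mul_cancel₀ _ hG0, sub_self]
  have hP0 : algebraMap k[X] (RatFunc k) P ≠ 0 := by simpa using hP.ne_zero
  have hGne : G ≠ 0 := by rintro rfl; simp at hPG
  have hG0 : algebraMap k[X] (RatFunc k) G ≠ 0 := by simpa using hGne
  obtain ⟨t, ht⟩ : ∃ t, p * u = u + t + 1 := ⟨p * u - u - 1, by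
    have := lt_mul_of_one_lt_left hu hp.one_lt; omega⟩
  set H : RatFunc k := algebraMap _ _ h / algebraMap _ _ P ^ u with hH
  have hD : D - H ^ p + H =
      algebraMap _ _ (A + h * P ^ t * G) / algebraMap _ _ (P ^ (u + t) * G) := by
    have hA' := congrArg (algebraMap k[X] (RatFunc k)) hA
    have e : D = algebraMap _ _ D.num / algebraMap _ _ D.denom := (RatFunc.num_div_denom D).symm
    rw [hG] at e
    simp only [map_sub, map_mul, map_pow] at hA' e
    rw [e, hH, div_pow, ← pow_mul, mul_comm u p, ht]
    simp only [map_add, map_mul, map_pow]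
    field_simp
    linear_combination algebraMap k[X] (RatFunc k) P ^ (2 * u + t) * hA'
  have hlt : (D - H ^ p + H).denom.natDegree < n := by
    rw [hD, ← hn, hG]
    refine (natDegree_le_of_dvd (RatFunc.denom_div_dvd _ _)
      (mul_ne_zero (pow_ne_zero _ hP.ne_zero) hGne)).trans_lt ?_
    rw [natDegree_mul (pow_ne_zero _ hP.ne_zero) hGne, natDegree_mul (pow_ne_zero _ hP.ne_zero) hGne,
      natDegree_pow, natDegree_pow, ht]
    have := hP.natDegree_pos
    have : (u + t + 1) * P.natDegree = (u + t) * P.natDegree + P.natDegree := by ring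
    omega
  obtain ⟨F, D', hFD, hD'⟩ := ih _ hlt _ rfl
  refine ⟨F + H, D', ?_, hD'⟩
  rw [add_pow_char]
  linear_combination hFD

section denom

variable {k : Type*} [Field k] {P : k[X]} {D D' : RatFunc k}

theorem not_dvd_denom_add (hP : Irreducible P) (h : ¬ P ∣ D.denom) (h' : ¬ P ∣ D'.denom) :
    ¬ P ∣ (D + D').denom := fun hd =>
  (hP.prime.dvd_or_dvd (hd.trans (RatFunc.denom_add_dvd D D'))).elim h h'

theorem not_dvd_denom_mul (hP : Irreducible P) (h : ¬ P ∣ D.denom) (h' : ¬ P ∣ D'.denom) :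
    ¬ P ∣ (D * D').denom := fun hd =>
  (hP.prime.dvd_or_dvd (hd.trans (RatFunc.denom_mul_dvd D D'))).elim h h'

theorem not_dvd_denom_pow (hP : Irreducible P) (h : ¬ P ∣ D.denom) (n : ℕ) :
    ¬ P ∣ (D ^ n).denom := by
  induction n with
  | zero =>
    rw [pow_zero, RatFunc.denom_one]
    exact fun h => hP.not_isUnit (isUnit_of_dvd_one h)
  | succ n ih => rw [pow_succ]; exact not_dvd_denom_mul hP ih h

theorem eval₂_denom_ne_zero [Fact (Irreducible P)] (h : ¬ P ∣ D.denom) :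
    D.denom.eval₂ (AdjoinRoot.of P) (AdjoinRoot.root P) ≠ 0 := by
  rwa [← AdjoinRoot.algebraMap_eq, ← aeval_def, AdjoinRoot.aeval_eq, ne_eq, AdjoinRoot.mk_eq_zero]

end denom

section hasseSymbol

variable {p : ℕ} [Fact p.Prime] {Fq : Type} [Field Fq] [Fintype Fq] [Algebra (ZMod p) Fq]

theorem hasseSymbol_eq_trace {P : Fq[X]} [Fact (Irreducible P)] (D : RatFunc Fq) :
    hasseSymbol p P D = Algebra.trace (ZMod p) (AdjoinRoot P)
      (D.eval (AdjoinRoot.of P) (AdjoinRoot.root P)) := by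
  have : Module.Finite Fq (AdjoinRoot P) :=
    (AdjoinRoot.powerBasis (Fact.out : Irreducible P).ne_zero).finite
  rw [hasseSymbol, Algebra.trace_trace, RatFunc.eval, Ring.inverse_eq_inv', div_eq_mul_inv]
  congr 3
  · rw [← AdjoinRoot.aeval_eq, aeval_def]; rfl
  · rw [← AdjoinRoot.aeval_eq, aeval_def]; rfl

theorem hasseSymbol_add {P : Fq[X]} (hP : Irreducible P) {D D' : RatFunc Fq}
    (h : ¬ P ∣ D.denom) (h' : ¬ P ∣ D'.denom) :
    hasseSymbol p P (D + D') = hasseSymbol p P D + hasseSymbol p P D' := by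
  have : Fact (Irreducible P) := ⟨hP⟩
  rw [hasseSymbol_eq_trace, hasseSymbol_eq_trace, hasseSymbol_eq_trace, ← map_add]
  exact congrArg _ (RatFunc.eval_add _ _ (eval₂_denom_ne_zero h) (eval₂_denom_ne_zero h'))

theorem hasseSymbol_C {P : Fq[X]} (hP : Irreducible P) (c : Fq) :
    hasseSymbol p P (RatFunc.C c) = P.natDegree * Algebra.trace (ZMod p) Fq c := by
  have : Fact (Irreducible P) := ⟨hP⟩
  have : Module.Finite Fq (AdjoinRoot P) := (AdjoinRoot.powerBasis hP.ne_zero).finite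
  rw [hasseSymbol_eq_trace, RatFunc.eval_C, ← Algebra.trace_trace (S := Fq),
    ← AdjoinRoot.algebraMap_eq, Algebra.trace_algebraMap,
    (AdjoinRoot.powerBasis hP.ne_zero).finrank, AdjoinRoot.powerBasis_dim, map_nsmul, nsmul_eq_mul]

theorem hasseSymbol_natCast_mul {P : Fq[X]} (hP : Irreducible P) (n : ℕ) {D : RatFunc Fq}
    (h : ¬ P ∣ D.denom) :
    hasseSymbol p P ((n : RatFunc Fq) * D) = n * hasseSymbol p P D := by
  have : Fact (Irreducible P) := ⟨hP⟩
  have hn : (n : RatFunc Fq) = RatFunc.C (n : Fq) := by simp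
  rw [hasseSymbol_eq_trace, hasseSymbol_eq_trace, hn, ← nsmul_eq_mul, ← map_nsmul]
  refine congrArg _ ((RatFunc.eval_mul _ _
    (by rw [RatFunc.denom_C, eval₂_one]; exact one_ne_zero) (eval₂_denom_ne_zero h)).trans ?_)
  rw [RatFunc.eval_C, map_natCast, nsmul_eq_mul]

theorem trace_pow_prime_eq {K : Type*} [Field K] [Finite K] [Algebra (ZMod p) K] (x : K) :
    Algebra.trace (ZMod p) K (x ^ p) = Algebra.trace (ZMod p) K x := by
  have : Fintype K := Fintype.ofFinite K
  apply (algebraMap (ZMod p) K).injective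
  rw [FiniteField.algebraMap_trace_eq_sum_pow, FiniteField.algebraMap_trace_eq_sum_pow,
    Nat.card_zmod]
  have h1 := Finset.sum_range_succ (fun i => x ^ p ^ i) (Module.finrank (ZMod p) K)
  rw [Finset.sum_range_succ', pow_zero, pow_one] at h1
  have h2 : x ^ p ^ Module.finrank (ZMod p) K = x := by
    have := FiniteField.pow_card x
    rwa [Module.card_eq_pow_finrank (K := ZMod p), ZMod.card] at this
  rw [h2] at h1
  simpa only [← pow_mul, ← pow_succ'] using add_right_cancel h1

theorem hasseSymbol_pow_prime {P : Fq[X]} (hP : Irreducible P) {F : RatFunc Fq}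
    (h : ¬ P ∣ F.denom) : hasseSymbol p P (F ^ p) = hasseSymbol p P F := by
  have : Fact (Irreducible P) := ⟨hP⟩
  have : Module.Finite Fq (AdjoinRoot P) := (AdjoinRoot.powerBasis hP.ne_zero).finite
  have : Finite (AdjoinRoot P) := Module.finite_of_finite Fq
  have hpow : ∀ n, (F ^ n).eval (AdjoinRoot.of P) (AdjoinRoot.root P) =
      F.eval (AdjoinRoot.of P) (AdjoinRoot.root P) ^ n := by
    intro n
    induction n with
    | zero => rw [pow_zero, pow_zero, RatFunc.eval_one]
    | succ n ih =>
      rw [pow_succ, pow_succ, ← ih]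
      exact RatFunc.eval_mul _ _ (eval₂_denom_ne_zero (not_dvd_denom_pow hP h n))
        (eval₂_denom_ne_zero h)
  rw [hasseSymbol_eq_trace, hasseSymbol_eq_trace, hpow, trace_pow_prime_eq]

theorem hasseSymbol_eq_of_eq_pow_sub_add {P : Fq[X]} (hP : Irreducible P) {D D' F : RatFunc Fq}
    (h : D = F ^ p - F + D') (hD : ¬ P ∣ D.denom) (hF : ¬ P ∣ F.denom) (hD' : ¬ P ∣ D'.denom) :
    hasseSymbol p P D = hasseSymbol p P D' := by
  have h1 : D + F = F ^ p + D' := by rw [h]; ring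
  have h2 := hasseSymbol_add (p := p) hP hD hF
  rw [h1, hasseSymbol_add hP (not_dvd_denom_pow hP hF p) hD', hasseSymbol_pow_prime hP hF] at h2
  linear_combination -h2

theorem hasseSymbol_sum_natCast_mul {P : Fq[X]} (hP : Irreducible P) {ι : Type*} (s : Finset ι)
    (n : ι → ℕ) {D : ι → RatFunc Fq} (h : ∀ i, ¬ P ∣ (D i).denom) :
    ¬ P ∣ (∑ i ∈ s, (n i : RatFunc Fq) * D i).denom ∧
      hasseSymbol p P (∑ i ∈ s, (n i : RatFunc Fq) * D i) =
        ∑ i ∈ s, (n i : ZMod p) * hasseSymbol p P (D i) := by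
  classical
  have hn : ∀ n : ℕ, ¬ P ∣ (n : RatFunc Fq).denom := by
    intro n
    rw [← map_natCast RatFunc.C, RatFunc.denom_C]
    exact fun h => hP.not_isUnit (isUnit_of_dvd_one h)
  induction s using Finset.induction_on with
  | empty =>
    refine ⟨by simpa using fun h => hP.not_isUnit (isUnit_of_dvd_one h), ?_⟩
    have : Fact (Irreducible P) := ⟨hP⟩
    rw [Finset.sum_empty, Finset.sum_empty, hasseSymbol_eq_trace, RatFunc.eval_zero, map_zero]
  | insert a s ha ih =>
    have hmul := not_dvd_denom_mul hP (hn (n a)) (h a)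
    rw [Finset.sum_insert ha, Finset.sum_insert ha, hasseSymbol_add hP hmul ih.1, ih.2,
      hasseSymbol_natCast_mul hP _ (h a)]
    exact ⟨not_dvd_denom_add hP hmul ih.1, rfl⟩

/-- The explicit formula for the Hasse symbol in terms of a root of `P`. -/
theorem algebraMap_hasseSymbol {L : Type*} [Field L] [Algebra Fq L] {P : Fq[X]}
    (hP : Irreducible P) {x : L} (hx : aeval x P = 0) (D : RatFunc Fq) :
    algebraMap Fq L (algebraMap (ZMod p) Fq (hasseSymbol p P D)) =
      ∑ i ∈ Finset.range (Module.finrank (ZMod p) Fq * P.natDegree),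
        (aeval x D.num / aeval x D.denom) ^ p ^ i := by
  have : Fact (Irreducible P) := ⟨hP⟩
  have : Module.Finite Fq (AdjoinRoot P) := (AdjoinRoot.powerBasis hP.ne_zero).finite
  have : Finite (AdjoinRoot P) := Module.finite_of_finite Fq
  let φ : AdjoinRoot P →ₐ[Fq] L := AdjoinRoot.liftAlgHom P (Algebra.ofId Fq L) x hx
  have hφ : φ (AdjoinRoot.root P) = x := AdjoinRoot.liftAlgHom_root ..
  have h1 : algebraMap Fq L (algebraMap (ZMod p) Fq (hasseSymbol p P D)) =
      φ (algebraMap (ZMod p) (AdjoinRoot P) (hasseSymbol p P D)) := by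
    rw [IsScalarTower.algebraMap_apply (ZMod p) Fq (AdjoinRoot P), AlgHom.commutes]
  have h2 : ∀ g : Fq[X], φ (g.eval₂ (AdjoinRoot.of P) (AdjoinRoot.root P)) = aeval x g := by
    intro g
    rw [← AdjoinRoot.algebraMap_eq, ← aeval_def, ← aeval_algHom_apply, hφ]
  rw [h1, hasseSymbol_eq_trace, FiniteField.algebraMap_trace_eq_sum_pow, Nat.card_zmod,
    map_sum, ← Module.finrank_mul_finrank (ZMod p) Fq (AdjoinRoot P),
    (AdjoinRoot.powerBasis hP.ne_zero).finrank, AdjoinRoot.powerBasis_dim]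
  simp only [RatFunc.eval, map_pow, map_div₀, h2]

end hasseSymbol

section counting

variable {Fq : Type*} [Field Fq] [Finite Fq]

theorem finite_setOf_natDegree_eq (n : ℕ) : {P : Fq[X] | P.natDegree = n}.Finite := by
  have h : Finite (degreeLT Fq (n + 1)) :=
    Finite.of_equiv _ (degreeLTEquiv Fq (n + 1)).toEquiv.symm
  refine Set.Finite.subset (s := (degreeLT Fq (n + 1) : Set Fq[X])) h fun P hP => ?_
  rw [SetLike.mem_coe, mem_degreeLT, degree_lt_iff_coeff_zero]
  intro m hm
  rw [Set.mem_ofPred_eq] at hP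
  exact coeff_eq_zero_of_natDegree_lt (by omega)

variable (Fq) in
/-- The monic irreducible polynomials of degree `n` over a finite field. -/
noncomputable def monicIrreducibles (n : ℕ) : Finset Fq[X] :=
  Set.Finite.toFinset (s := {P : Fq[X] | P.Monic ∧ Irreducible P ∧ P.natDegree = n})
    ((finite_setOf_natDegree_eq n).subset fun _ hP => hP.2.2)

theorem mem_monicIrreducibles {n : ℕ} {P : Fq[X]} :
    P ∈ monicIrreducibles Fq n ↔ P.Monic ∧ Irreducible P ∧ P.natDegree = n := by
  simp [monicIrreducibles]

theorem pow_card_pow_eq_of_aeval_eq_zero {L : Type*} [Field L] [Algebra Fq L] {n : ℕ} {P : Fq[X]} (hP : Irreducible P)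
    (hn : P.natDegree ∣ n) {x : L} (hx : aeval x P = 0) : x ^ Nat.card Fq ^ n = x := by
  obtain ⟨R, hR⟩ := hP.natDegree_dvd_iff_dvd_X_pow_card_pow_sub_X.1 hn
  have := congrArg (aeval x) hR
  rw [map_mul, hx, zero_mul] at this
  simpa [sub_eq_zero] using this

variable (L : Type*) [Field L] [IsAlgClosed L] [Algebra Fq L]

open Classical in
theorem card_biUnion_aroots {n : ℕ} {S : Finset Fq[X]} (hS : S ⊆ monicIrreducibles Fq n) :
    (S.biUnion fun P => (P.aroots L).toFinset).card = n * S.card := by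
  rw [Finset.card_biUnion, Finset.sum_congr rfl (g := fun _ => n), Finset.sum_const, smul_eq_mul,
    mul_comm]
  · intro P hP
    obtain ⟨-, hi, hn⟩ := mem_monicIrreducibles.1 (hS hP)
    have hsep : (P.map (algebraMap Fq L)).Separable :=
      (PerfectField.separable_of_irreducible hi).map
    rw [Multiset.toFinset_card_of_nodup (nodup_roots hsep),
      IsAlgClosed.card_roots_eq_natDegree, natDegree_map, hn]
  · intro P hP Q hQ hPQ
    refine Finset.disjoint_left.2 fun x hx hx' => hPQ ?_
    obtain ⟨hPm, hPi, -⟩ := mem_monicIrreducibles.1 (hS hP)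
    obtain ⟨hQm, hQi, -⟩ := mem_monicIrreducibles.1 (hS hQ)
    rw [Multiset.mem_toFinset, mem_aroots] at hx hx'
    rw [minpoly.eq_of_irreducible_of_monic hPi hx.2 hPm,
      minpoly.eq_of_irreducible_of_monic hQi hx'.2 hQm]

open Classical in
theorem card_roots_X_pow_card_pow_sub_X {n : ℕ} (hn : n ≠ 0) :
    ((X ^ Nat.card Fq ^ n - X : L[X]).roots.toFinset).card = Nat.card Fq ^ n := by
  obtain ⟨p, hp⟩ := CharP.exists Fq
  have : CharP L p := charP_of_injective_algebraMap (algebraMap Fq L).injective p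
  have : Fact p.Prime := ⟨CharP.char_is_prime Fq p⟩
  have := Fintype.ofFinite Fq
  obtain ⟨m, -, hm⟩ := FiniteField.card Fq p
  have hsep : (X ^ Nat.card Fq ^ n - X : L[X]).Separable := by
    refine galois_poly_separable p _ (dvd_pow ?_ hn)
    rw [Nat.card_eq_fintype_card, hm]
    exact dvd_pow_self _ m.ne_zero
  rw [Multiset.toFinset_card_of_nodup (nodup_roots hsep),
      IsAlgClosed.card_roots_eq_natDegree,
      FiniteField.X_pow_card_pow_sub_X_natDegree_eq _ hn Finite.one_lt_card]

theorem mul_card_monicIrreducibles_le {n : ℕ} (hn : n ≠ 0) :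
    n * (monicIrreducibles Fq n).card ≤ Nat.card Fq ^ n := by
  classical
  let L := AlgebraicClosure Fq
  rw [← card_biUnion_aroots L subset_rfl, ← card_roots_X_pow_card_pow_sub_X L hn]
  refine Finset.card_le_card fun x hx => ?_
  simp only [Finset.mem_biUnion, Multiset.mem_toFinset, mem_aroots] at hx
  obtain ⟨P, hP, -, hx⟩ := hx
  obtain ⟨-, hi, hd⟩ := mem_monicIrreducibles.1 hP
  rw [Multiset.mem_toFinset, mem_roots (FiniteField.X_pow_card_pow_sub_X_ne_zero _ hn
    Finite.one_lt_card)]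
  simp [pow_card_pow_eq_of_aeval_eq_zero hi hd.dvd hx]

theorem card_pow_le_mul_card_monicIrreducibles_add {n : ℕ} (hn : n ≠ 0) :
    Nat.card Fq ^ n ≤ n * (monicIrreducibles Fq n).card + n * Nat.card Fq ^ (n / 2) := by
  classical
  let L := AlgebraicClosure Fq
  let R : ℕ → Finset L := fun d => (X ^ Nat.card Fq ^ d - X : L[X]).roots.toFinset
  have hR : ∀ d ≠ 0, (R d).card = Nat.card Fq ^ d := fun d hd =>
    card_roots_X_pow_card_pow_sub_X L hd
  have hmem : ∀ d ≠ 0, ∀ x, x ∈ R d ↔ x ^ Nat.card Fq ^ d = x := fun d hd x => by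
    rw [Multiset.mem_toFinset, mem_roots (FiniteField.X_pow_card_pow_sub_X_ne_zero _ hd
      Finite.one_lt_card)]
    simp [sub_eq_zero]
  have hsub : R n ⊆ ((monicIrreducibles Fq n).biUnion fun P => (P.aroots L).toFinset) ∪
      (Finset.Icc 1 (n / 2)).biUnion R := by
    intro x hx
    rw [hmem n hn] at hx
    have hint : IsIntegral Fq x := Algebra.IsIntegral.isIntegral x
    have hi := minpoly.irreducible hint
    have hdvd : (minpoly Fq x).natDegree ∣ n := by
      rw [hi.natDegree_dvd_iff_dvd_X_pow_card_pow_sub_X]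
      refine minpoly.dvd _ _ ?_
      simp [hx]
    rw [Finset.mem_union, Finset.mem_biUnion, Finset.mem_biUnion]
    by_cases hd : (minpoly Fq x).natDegree = n
    · refine Or.inl ⟨minpoly Fq x, mem_monicIrreducibles.2 ⟨minpoly.monic hint, hi, hd⟩, ?_⟩
      rw [Multiset.mem_toFinset, mem_aroots]
      exact ⟨hi.ne_zero, minpoly.aeval _ _⟩
    · have hpos := hi.natDegree_pos
      refine Or.inr ⟨(minpoly Fq x).natDegree, Finset.mem_Icc.2 ⟨hpos, ?_⟩,
        (hmem _ hpos.ne' _).2 (pow_card_pow_eq_of_aeval_eq_zero hi dvd_rfl (minpoly.aeval _ _))⟩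
      obtain ⟨k, hk⟩ := hdvd
      rw [Nat.le_div_iff_mul_le two_pos]
      have : 2 ≤ k := by
        rcases k with _ | _ | k
        · simp at hk; omega
        · simp at hk; omega
        · omega
      calc _ ≤ (minpoly Fq x).natDegree * k := by gcongr
        _ = n := hk.symm
  rw [← hR n hn, ← card_biUnion_aroots L (subset_refl (monicIrreducibles Fq n))]
  refine (Finset.card_le_card hsub).trans ((Finset.card_union_le _ _).trans ?_)
  gcongr
  refine Finset.card_biUnion_le.trans ?_
  calc ∑ d ∈ Finset.Icc 1 (n / 2), (R d).card
      ≤ ∑ d ∈ Finset.Icc 1 (n / 2), Nat.card Fq ^ (n / 2) := by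
        refine Finset.sum_le_sum fun d hd => ?_
        rw [Finset.mem_Icc] at hd
        rw [hR d (by omega)]
        exact Nat.pow_le_pow_right Nat.card_pos hd.2
    _ ≤ n * Nat.card Fq ^ (n / 2) := by
        rw [Finset.sum_const, smul_eq_mul, Nat.card_Icc]
        gcongr
        omega

theorem tendsto_mul_card_monicIrreducibles_div :
    Tendsto (fun n : ℕ => (n * (monicIrreducibles Fq n).card : ℝ) / Nat.card Fq ^ n) atTop
      (nhds 1) := by
  set q := Nat.card Fq
  have hq : 1 < q := Finite.one_lt_card
  have hq' : (1 : ℝ) < q := by exact_mod_cast hq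
  have hlim : Tendsto (fun n : ℕ => 1 - (n : ℝ) / Real.sqrt q ^ n) atTop (nhds 1) := by
    have h := tendsto_pow_const_div_const_pow_of_one_lt 1
      (Real.lt_sqrt_of_sq_lt (show (1 : ℝ) ^ 2 < q by simpa using hq'))
    simpa using h.const_sub 1
  refine tendsto_of_tendsto_of_tendsto_of_le_of_le' hlim tendsto_const_nhds ?_ ?_
  · filter_upwards [eventually_ne_atTop 0] with n hn
    have h : (q : ℝ) ^ n ≤ n * (monicIrreducibles Fq n).card + n * (q : ℝ) ^ (n / 2) := by
      exact_mod_cast card_pow_le_mul_card_monicIrreducibles_add (Fq := Fq) hn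
    have hs : 1 ≤ Real.sqrt q := Real.one_le_sqrt.2 hq'.le
    have hs2 : Real.sqrt q ^ 2 = q := Real.sq_sqrt (by positivity)
    have h2 : (q : ℝ) ^ (n / 2) ≤ Real.sqrt q ^ n := by
      rw [← hs2, Real.sqrt_sq (by positivity), ← pow_mul]
      exact pow_le_pow_right₀ hs (Nat.mul_div_le n 2)
    rw [le_div_iff₀ (by positivity), sub_mul, one_mul]
    have h3 : (n : ℝ) / Real.sqrt q ^ n * q ^ n = n * Real.sqrt q ^ n := by
      have : (q : ℝ) ^ n = Real.sqrt q ^ n * Real.sqrt q ^ n := by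
        rw [← mul_pow, ← sq, hs2]
      rw [this]
      field_simp
    rw [h3]
    have := mul_le_mul_of_nonneg_left h2 (Nat.cast_nonneg (α := ℝ) n)
    linarith
  · filter_upwards [eventually_ne_atTop 0] with n hn
    rw [div_le_one (by positivity)]
    exact_mod_cast mul_card_monicIrreducibles_le (Fq := Fq) hn

end counting

section equidistribution

variable {p : ℕ} [Fact p.Prime] {Fq : Type} [Field Fq] [Fintype Fq] [Algebra (ZMod p) Fq]

/-- The monic irreducible polynomials of degree `n` at which `D` has Hasse symbol `c`. -/
noncomputable def hasseFiber (n : ℕ) (D : RatFunc Fq) (c : ZMod p) : Finset Fq[X] :=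
  (monicIrreducibles Fq n).filter fun P => hasseSymbol p P D = c

theorem mem_hasseFiber {n : ℕ} {D : RatFunc Fq} {c : ZMod p} {P : Fq[X]} :
    P ∈ hasseFiber n D c ↔ P ∈ monicIrreducibles Fq n ∧ hasseSymbol p P D = c :=
  Finset.mem_filter

theorem sum_card_hasseFiber (n : ℕ) (D : RatFunc Fq) :
    ∑ c : ZMod p, (hasseFiber n D c).card = (monicIrreducibles Fq n).card :=
  (Finset.card_eq_sum_card_fiberwise (f := fun P => hasseSymbol p P D) (t := Finset.univ)
    fun _ _ => Finset.mem_coe.2 (Finset.mem_univ _)).symm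

theorem exists_mul_card_hasseFiber_le (L : Type*) [Field L] [IsAlgClosed L] [Algebra Fq L]
    (D : RatFunc Fq)
    (hD : HasPrimeToPole p (D.num.map (algebraMap Fq L)) (D.denom.map (algebraMap Fq L))) :
    ∃ C : ℕ, ∀ n, 2 ≤ n → D.denom.natDegree < n → ∀ c : ZMod p,
      n * (hasseFiber n D c).card ≤
        p ^ (Module.finrank (ZMod p) Fq * n - 1) +
          C * p ^ (Module.finrank (ZMod p) Fq * n / 2) := by
  classical
  have : CharP Fq p := charP_of_injective_algebraMap (algebraMap (ZMod p) Fq).injective p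
  have : CharP L p := charP_of_injective_algebraMap (algebraMap Fq L).injective p
  obtain ⟨s, v, ε, d, hε, hs, hd, hpd, hv⟩ := hD
  set δ := max D.num.natDegree D.denom.natDegree
  have he : 0 < Module.finrank (ZMod p) Fq := Module.finrank_pos
  have hcard : p ^ Module.finrank (ZMod p) Fq = Nat.card Fq := by
    rw [Module.natCard_eq_pow_finrank (K := ZMod p) (V := Fq), Nat.card_zmod]
  refine ⟨1 + p * (δ * p ^ 2 + 3) + δ * p ^ 2, fun n hn hdn c => ?_⟩
  have hsub : hasseFiber n D c ⊆ monicIrreducibles Fq n := Finset.filter_subset _ _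
  rw [← card_biUnion_aroots L hsub]
  have key : ∀ x ∈ (hasseFiber n D c).biUnion fun P => (P.aroots L).toFinset,
      ∃ P : Fq[X], Irreducible P ∧ P.natDegree = n ∧ hasseSymbol p P D = c ∧ aeval x P = 0 := by
    intro x hx
    simp only [Finset.mem_biUnion, Multiset.mem_toFinset, mem_aroots] at hx
    obtain ⟨P, hP, -, hx⟩ := hx
    rw [mem_hasseFiber, mem_monicIrreducibles] at hP
    exact ⟨P, hP.1.2.1, hP.1.2.2, hP.2, hx⟩
  have hpow : ∀ x ∈ (hasseFiber n D c).biUnion fun P => (P.aroots L).toFinset,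
      x ^ p ^ (Module.finrank (ZMod p) Fq * n) = x := by
    intro x hx
    obtain ⟨P, hi, hPn, -, hx⟩ := key x hx
    rw [pow_mul, hcard]
    exact pow_card_pow_eq_of_aeval_eq_zero hi hPn.dvd hx
  refine stepanov_card_le_pow (L := L) (p := p)
    (N := D.num.map (algebraMap Fq L)) (E := D.denom.map (algebraMap Fq L))
    (a := algebraMap Fq L (algebraMap (ZMod p) Fq c))
    ((Polynomial.map_ne_zero_iff (algebraMap Fq L).injective).2 D.denom_ne_zero)
    (δ := δ) (by simp [δ]) (by simp [δ]) hε hs hd hpd hv (by nlinarith) _ hpow ?_ ?_ ?_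
  · intro x hx
    obtain ⟨P, hi, hPn, hc, hx⟩ := key x hx
    rw [eval_map_algebraMap]
    intro h0
    have hdvd := minpoly.dvd Fq x h0
    have : P.natDegree ≤ D.denom.natDegree := by
      have hP : P ∣ D.denom := by
        by_contra hnd
        obtain ⟨u, w, huw⟩ := (hi.coprime_iff_not_dvd).2 hnd
        have := congrArg (aeval x) huw
        simp [hx, h0] at this
      exact natDegree_le_of_dvd hP D.denom_ne_zero
    omega
  · intro x hx
    have := hpow x hx
    rw [pow_mul, hcard, Nat.card_eq_fintype_card] at this ⊢
    rw [eval_map_algebraMap]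
    have hφ : ∀ y : L, ((FiniteField.frobeniusAlgHom Fq L) ^ n) y = y ^ Fintype.card Fq ^ n := by
      intro y
      rw [AlgHom.coe_pow, FiniteField.coe_frobeniusAlgHom, pow_iterate]
    rw [← hφ, ← aeval_algHom_apply, hφ, this]
  · intro x hx
    obtain ⟨P, hi, hPn, hc, hx⟩ := key x hx
    rw [← hc, algebraMap_hasseSymbol hi hx D, hPn]
    simp only [eval_map_algebraMap]

theorem tendsto_mul_card_hasseFiber_div (L : Type*) [Field L] [IsAlgClosed L] [Algebra Fq L]
    (D : RatFunc Fq)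
    (hD : HasPrimeToPole p (D.num.map (algebraMap Fq L)) (D.denom.map (algebraMap Fq L)))
    (c : ZMod p) :
    Tendsto (fun n : ℕ => (n * (hasseFiber n D c).card : ℝ) / Nat.card Fq ^ n) atTop
      (nhds (1 / p)) := by
  obtain ⟨C, hC⟩ := exists_mul_card_hasseFiber_le L D hD
  set e := Module.finrank (ZMod p) Fq
  have he : 0 < e := Module.finrank_pos
  have hp : (1 : ℝ) < p := by exact_mod_cast (Fact.out : p.Prime).one_lt
  have hcard : (Nat.card Fq : ℝ) = (p : ℝ) ^ e := by
    rw [Module.natCard_eq_pow_finrank (K := ZMod p) (V := Fq), Nat.card_zmod, Nat.cast_pow]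
  set g : ℝ → ℕ → ℝ := fun a n => a + C * (1 / (p : ℝ)) ^ (n / 2) with hg
  set f : ZMod p → ℕ → ℝ := fun c n => (n * (hasseFiber n D c).card : ℝ) / Nat.card Fq ^ n
  have hbound : ∀ᶠ n in atTop, ∀ c, f c n ≤ g (1 / p) n := by
    filter_upwards [eventually_ge_atTop 2, eventually_gt_atTop D.denom.natDegree] with n hn hdn c
    have h := hC n hn hdn c
    have h1 : (n * (hasseFiber n D c).card : ℝ) ≤
        (p : ℝ) ^ (e * n - 1) + C * (p : ℝ) ^ (e * n / 2) := by exact_mod_cast h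
    have hen : n ≤ e * n := Nat.le_mul_of_pos_left n he
    rw [div_le_iff₀ (by rw [hcard]; positivity)]
    refine h1.trans ?_
    simp only [hg]
    rw [add_mul, hcard, ← pow_mul]
    gcongr ?_ + ?_
    · obtain ⟨m, hm⟩ : ∃ m, e * n = m + 1 := ⟨e * n - 1, by omega⟩
      rw [hm, Nat.add_sub_cancel, pow_succ]
      field_simp
      rfl
    · rw [mul_assoc]
      gcongr
      rw [one_div, inv_pow, ← div_eq_inv_mul, le_div_iff₀ (by positivity), ← pow_add]
      exact pow_le_pow_right₀ hp.le (by omega)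
  have hglim : ∀ a, Tendsto (g a) atTop (nhds a) := fun a => by
    have h := (tendsto_pow_atTop_nhds_zero_of_lt_one (r := 1 / (p : ℝ)) (by positivity)
      ((div_lt_one (by positivity)).2 hp)).comp (Nat.tendsto_div_const_atTop two_ne_zero)
    simpa [hg] using (h.const_mul (C : ℝ)).const_add a
  have hsum : Tendsto (fun n => ∑ c, f c n) atTop (nhds 1) := by
    refine (tendsto_mul_card_monicIrreducibles_div (Fq := Fq)).congr fun n => ?_
    rw [← sum_card_hasseFiber (p := p) n D, Nat.cast_sum, Finset.mul_sum, Finset.sum_div]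
  have hlow : Tendsto (fun n => ∑ c, f c n - ∑ x ∈ Finset.univ.erase c, g (1 / p) n) atTop
      (nhds (1 / p)) := by
    have h := hsum.sub ((hglim (1 / p)).const_mul (p - 1 : ℝ))
    convert h using 2
    · rw [Finset.sum_const, Finset.card_erase_of_mem (Finset.mem_univ _), Finset.card_univ,
        ZMod.card, nsmul_eq_mul, Nat.cast_sub (Fact.out : p.Prime).one_le, Nat.cast_one]
    · field_simp
      ring
  refine tendsto_of_tendsto_of_tendsto_of_le_of_le' hlow (hglim (1 / p)) ?_ ?_
  · filter_upwards [hbound] with n hn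
    rw [sub_le_iff_le_add, ← Finset.add_sum_erase _ _ (Finset.mem_univ c)]
    exact add_le_add_right (Finset.sum_le_sum fun x _ => hn x) _
  · filter_upwards [hbound] with n hn using hn c

end equidistribution

section additiveHilbert

variable {p : ℕ} [Fact p.Prime] {K : Type*} [Field K] [Finite K] [Algebra (ZMod p) K]

theorem exists_pow_prime_sub_eq_iff {c : K} :
    (∃ b : K, b ^ p - b = c) ↔ Algebra.trace (ZMod p) K c = 0 := by
  have : CharP K p := charP_of_injective_algebraMap (algebraMap (ZMod p) K).injective p
  let φ : K →ₗ[ZMod p] K :=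
    (FiniteField.frobeniusAlgHom (ZMod p) K).toLinearMap - LinearMap.id
  have hφ : ∀ x, φ x = x ^ p - x := fun x => by
    simp [φ, ZMod.card]
  have hle : LinearMap.range φ ≤ LinearMap.ker (Algebra.trace (ZMod p) K) := by
    rintro _ ⟨x, rfl⟩
    rw [LinearMap.mem_ker, hφ, map_sub, trace_pow_prime_eq, sub_self]
  have hker : Module.finrank (ZMod p) (LinearMap.ker φ) ≤ 1 := by
    refine (Submodule.finrank_mono (t := Submodule.span (ZMod p) {(1 : K)}) fun x hx => ?_).trans
      (finrank_span_singleton (one_ne_zero)).le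
    rw [LinearMap.mem_ker, hφ, sub_eq_zero] at hx
    have := (Subfield.mem_bot_iff_pow_eq_self (F := K) (p := p)).2 hx
    rw [Subfield.bot_eq_of_zMod_algebra (p := p), RingHom.mem_fieldRange] at this
    obtain ⟨y, rfl⟩ := this
    rw [Algebra.algebraMap_eq_smul_one]
    exact Submodule.smul_mem _ _ (Submodule.mem_span_singleton_self _)
  have htr : Module.finrank (ZMod p) (LinearMap.range (Algebra.trace (ZMod p) K)) = 1 := by
    rw [LinearMap.range_eq_top.2 (Algebra.trace_surjective (ZMod p) K), finrank_top,
      Module.finrank_self]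
  have h1 := LinearMap.finrank_range_add_finrank_ker φ
  have h2 := LinearMap.finrank_range_add_finrank_ker (Algebra.trace (ZMod p) K)
  have heq := Submodule.eq_of_le_of_finrank_le hle (by omega)
  rw [← LinearMap.mem_ker, ← heq, LinearMap.mem_range]
  simp only [hφ]

end additiveHilbert

section trichotomy

variable {p : ℕ} [Fact p.Prime] {Fq : Type} [Field Fq] [Fintype Fq] [Algebra (ZMod p) Fq]

theorem not_dvd_of_mem_monicIrreducibles {n : ℕ} {P Q : Fq[X]} (hP : P ∈ monicIrreducibles Fq n)
    (hQ : Q ≠ 0) (hn : Q.natDegree < n) : ¬ P ∣ Q := fun h => by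
  have h1 := natDegree_le_of_dvd h hQ
  rw [(mem_monicIrreducibles.1 hP).2.2] at h1
  omega

theorem hasseFiber_eq_of_eq_pow_sub_add {D D' F : RatFunc Fq} (h : D = F ^ p - F + D') (c : ZMod p) :
    ∀ᶠ n in atTop, hasseFiber n D c = hasseFiber n D' c := by
  filter_upwards [eventually_gt_atTop D.denom.natDegree, eventually_gt_atTop D'.denom.natDegree,
    eventually_gt_atTop F.denom.natDegree] with n h1 h2 h3
  refine Finset.filter_congr fun P hP => ?_
  rw [hasseSymbol_eq_of_eq_pow_sub_add (mem_monicIrreducibles.1 hP).2.1 h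
    (not_dvd_of_mem_monicIrreducibles hP D.denom_ne_zero h1)
    (not_dvd_of_mem_monicIrreducibles hP F.denom_ne_zero h3)
    (not_dvd_of_mem_monicIrreducibles hP D'.denom_ne_zero h2)]

/-- The asymptotic proportion of the monic irreducibles of degree `n` with vanishing Hasse symbol
at `D`. -/
noncomputable def hasseProportion (p : ℕ) {Fq : Type} [Field Fq] (D : RatFunc Fq) (n : ℕ) : ℝ :=
  open Classical in
  if ∃ F : RatFunc Fq, D = F ^ p - F then 1
  else if ∃ (F : RatFunc Fq) (c : Fq), D = F ^ p - F + RatFunc.C c then if p ∣ n then 1 else 0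
  else 1 / p

theorem tendsto_card_hasseFiber_zero_sub_hasseProportion (D : RatFunc Fq) :
    Tendsto (fun n : ℕ => (n * (hasseFiber n D (0 : ZMod p)).card : ℝ) / Nat.card Fq ^ n -
      hasseProportion p D n) atTop (nhds 0) := by
  have : CharP Fq p := charP_of_injective_algebraMap (algebraMap (ZMod p) Fq).injective p
  have hC : ∀ {n : ℕ} {P : Fq[X]} (_ : P ∈ monicIrreducibles Fq n) (c : Fq),
      hasseSymbol p P (RatFunc.C c) = n * Algebra.trace (ZMod p) Fq c := fun hP c => by
    rw [hasseSymbol_C (mem_monicIrreducibles.1 hP).2.1, (mem_monicIrreducibles.1 hP).2.2]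
  have hw := (tendsto_mul_card_monicIrreducibles_div (Fq := Fq)).sub_const 1
  rw [sub_self] at hw
  by_cases h1 : ∃ F : RatFunc Fq, D = F ^ p - F
  · obtain ⟨F, hF⟩ := id h1
    refine hw.congr' ?_
    have hF0 : D = F ^ p - F + RatFunc.C 0 := by rwa [map_zero, add_zero]
    filter_upwards [hasseFiber_eq_of_eq_pow_sub_add hF0 (0 : ZMod p)] with n hn
    rw [hn, hasseProportion, if_pos h1, hasseFiber, Finset.filter_true_of_mem]
    intro P hP
    rw [hC hP, map_zero, mul_zero]
  by_cases h2 : ∃ (F : RatFunc Fq) (c : Fq), D = F ^ p - F + RatFunc.C c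
  · obtain ⟨F, c, hF⟩ := id h2
    have hc : Algebra.trace (ZMod p) Fq c ≠ 0 := by
      rw [ne_eq, ← exists_pow_prime_sub_eq_iff]
      rintro ⟨b, rfl⟩
      have : CharP (RatFunc Fq) p :=
        charP_of_injective_algebraMap (algebraMap Fq (RatFunc Fq)).injective p
      refine h1 ⟨F + RatFunc.C b, ?_⟩
      rw [hF, add_pow_char, map_sub, map_pow]
      ring
    have hlim := hw.abs
    rw [abs_zero] at hlim
    refine squeeze_zero_norm' ?_ hlim
    filter_upwards [hasseFiber_eq_of_eq_pow_sub_add hF (0 : ZMod p)] with n hn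
    rw [hn, hasseProportion, if_neg h1, if_pos h2, hasseFiber, Real.norm_eq_abs]
    split_ifs with hpn
    · rw [Finset.filter_true_of_mem]
      intro P hP
      rw [hC hP, (ZMod.natCast_eq_zero_iff n p).2 hpn, zero_mul]
    · rw [Finset.filter_false_of_mem]
      · simp
      · intro P hP
        rw [hC hP]
        exact mul_ne_zero (mt (ZMod.natCast_eq_zero_iff n p).1 hpn) hc
  · obtain ⟨F, D', hD, ⟨c, rfl⟩ | hpole⟩ :=
      RatFunc.exists_artinSchreier_reduction p (AlgebraicClosure Fq) D
    · exact absurd ⟨F, c, hD⟩ h2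
    · have h := (tendsto_mul_card_hasseFiber_div _ D' hpole (0 : ZMod p)).sub_const (1 / p : ℝ)
      rw [sub_self] at h
      refine h.congr' ?_
      filter_upwards [hasseFiber_eq_of_eq_pow_sub_add hD (0 : ZMod p)] with n hn
      rw [hn, hasseProportion, if_neg h1, if_neg h2]

end trichotomy

section combination

variable {p : ℕ} [Fact p.Prime]

theorem mul_card_filter_sum_mul_eq_zero_sub {l : ℕ} (v : Fin l → ZMod p) :
    (p * (Finset.univ.filter fun a : Fin l → ZMod p => ∑ i, a i * v i = 0).card - p ^ l : ℝ) =
      if ∀ i, v i = 0 then ((p : ℝ) - 1) * (p : ℝ) ^ l else 0 := by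
  split_ifs with hv
  · rw [Finset.filter_true_of_mem (fun a _ => by simp [hv]), Finset.card_univ, Fintype.card_fun,
      ZMod.card, Fintype.card_fin, Nat.cast_pow]
    ring
  · push Not at hv
    obtain ⟨j, hj⟩ := hv
    let φ : (Fin l → ZMod p) →ₗ[ZMod p] ZMod p := ∑ i, v i • LinearMap.proj i
    have hφ : ∀ a, φ a = ∑ i, a i * v i := fun a => by
      simp [φ, mul_comm]
    have hsurj : LinearMap.range φ = ⊤ := by
      refine LinearMap.range_eq_top.2 fun c => ⟨Pi.single j (c / v j), ?_⟩
      rw [hφ, Finset.sum_eq_single j (fun i _ hi => by rw [Pi.single_eq_of_ne hi, zero_mul])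
        (by simp), Pi.single_eq_same, div_mul_cancel₀ _ hj]
    have hrank := LinearMap.finrank_range_add_finrank_ker φ
    rw [hsurj, finrank_top, Module.finrank_self, Module.finrank_fin_fun] at hrank
    have hcard : (Finset.univ.filter fun a : Fin l → ZMod p => ∑ i, a i * v i = 0).card =
        p ^ Module.finrank (ZMod p) (LinearMap.ker φ) := by
      rw [← Nat.subtype_card (p := fun a => a ∈ LinearMap.ker φ) _
        (fun a => by simp [LinearMap.mem_ker, hφ])]
      exact (Module.natCard_eq_pow_finrank (K := ZMod p)).trans (by rw [Nat.card_zmod])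
    rw [hcard, ← Nat.cast_pow, ← Nat.cast_mul, ← pow_succ', Nat.add_comm, hrank,
      Nat.cast_pow, sub_self]

variable {Fq : Type} [Field Fq] [Fintype Fq] [Algebra (ZMod p) Fq] {l : ℕ}

/-- The monic irreducible polynomials of degree `n` at which all the `D i` have vanishing
Hasse symbol. -/
noncomputable def hasseCommonZeros (p : ℕ) [Fact p.Prime] {Fq : Type} [Field Fq] [Fintype Fq]
    [Algebra (ZMod p) Fq] {l : ℕ} (n : ℕ) (D : Fin l → RatFunc Fq) : Finset Fq[X] :=
  (monicIrreducibles Fq n).filter fun P => ∀ i, hasseSymbol p P (D i) = 0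

theorem sum_mul_card_hasseFiber_sub {n : ℕ} (D : Fin l → RatFunc Fq)
    (h : ∀ P ∈ monicIrreducibles Fq n, ∀ i, ¬ P ∣ (D i).denom) :
    ∑ a : Fin l → ZMod p, (p * (hasseFiber n (∑ i, ((a i).val : RatFunc Fq) * D i)
      (0 : ZMod p)).card - (monicIrreducibles Fq n).card : ℝ) =
      (p - 1) * p ^ l * (hasseCommonZeros p n D).card := by
  have hsym : ∀ P ∈ monicIrreducibles Fq n, ∀ a : Fin l → ZMod p,
      hasseSymbol p P (∑ i, ((a i).val : RatFunc Fq) * D i) =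
        ∑ i, a i * hasseSymbol p P (D i) := fun P hP a => by
    rw [(hasseSymbol_sum_natCast_mul (mem_monicIrreducibles.1 hP).2.1 Finset.univ
      (fun i => (a i).val) (h P hP)).2]
    simp
  have h1 : ∀ a : Fin l → ZMod p, ((hasseFiber n (∑ i, ((a i).val : RatFunc Fq) * D i)
      (0 : ZMod p)).card : ℝ) = ∑ P ∈ monicIrreducibles Fq n,
        if ∑ i, a i * hasseSymbol p P (D i) = 0 then 1 else 0 := fun a => by
    rw [Finset.sum_boole, hasseFiber, Finset.filter_congr fun P hP => by rw [hsym P hP]]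
  have h2 : ∀ P : Fq[X], ((Finset.univ.filter fun a : Fin l → ZMod p =>
      ∑ i, a i * hasseSymbol p P (D i) = 0).card : ℝ) =
        ∑ a : Fin l → ZMod p, if ∑ i, a i * hasseSymbol p P (D i) = 0 then 1 else 0 :=
    fun P => (Finset.sum_boole _ _).symm
  have h3 : ((hasseCommonZeros p n D).card : ℝ) = ∑ P ∈ monicIrreducibles Fq n,
      if ∀ i, hasseSymbol p P (D i) = 0 then 1 else 0 := (Finset.sum_boole _ _).symm
  rw [Finset.sum_sub_distrib, ← Finset.mul_sum, Finset.sum_congr rfl fun a _ => h1 a,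
    Finset.sum_comm, h3, Finset.mul_sum, Finset.mul_sum, Finset.sum_const, Finset.card_univ,
    Fintype.card_fun, ZMod.card, Fintype.card_fin, nsmul_eq_mul, Nat.cast_pow, mul_comm (_ ^ l : ℝ),
    ← nsmul_eq_mul, ← Finset.sum_const, ← Finset.sum_sub_distrib]
  refine Finset.sum_congr rfl fun P _ => ?_
  rw [← h2, mul_card_filter_sum_mul_eq_zero_sub]
  simp

theorem tendsto_card_hasseCommonZeros (D : Fin l → RatFunc Fq) :
    Tendsto (fun n : ℕ => (n * (hasseCommonZeros p n D).card : ℝ) / Nat.card Fq ^ n -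
      (∑ a : Fin l → ZMod p, (p * hasseProportion p (∑ i, ((a i).val : RatFunc Fq) * D i) n - 1)) /
        ((p - 1) * p ^ l)) atTop (nhds 0) := by
  have hp : (1 : ℝ) < p := by exact_mod_cast (Fact.out : p.Prime).one_lt
  have hw := (tendsto_mul_card_monicIrreducibles_div (Fq := Fq)).sub_const 1
  have hlim := tendsto_finsetSum (Finset.univ (α := Fin l → ZMod p)) fun a _ =>
    ((tendsto_card_hasseFiber_zero_sub_hasseProportion (p := p)
      (∑ i, ((a i).val : RatFunc Fq) * D i)).const_mul (p : ℝ)).sub hw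
  have hlim2 := hlim.div_const ((p - 1) * p ^ l : ℝ)
  simp only [mul_zero, sub_self, Finset.sum_const_zero, zero_div] at hlim2
  refine hlim2.congr' ?_
  have hden : ∀ᶠ n in atTop, ∀ i, (D i).denom.natDegree < n :=
    eventually_all.2 fun i => eventually_gt_atTop _
  filter_upwards [hden] with n hn
  have key := sum_mul_card_hasseFiber_sub (p := p) D fun P hP i =>
    not_dvd_of_mem_monicIrreducibles hP (D i).denom_ne_zero (hn i)
  have hne : ((p - 1) * p ^ l : ℝ) ≠ 0 := mul_ne_zero (by linarith) (by positivity)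
  rw [eq_sub_iff_add_eq, ← add_div, ← Finset.sum_add_distrib, div_eq_iff hne]
  have : (n * (hasseCommonZeros p n D).card : ℝ) / Nat.card Fq ^ n * ((p - 1) * p ^ l) =
      n / Nat.card Fq ^ n * ((p - 1) * p ^ l * (hasseCommonZeros p n D).card) := by ring
  rw [this, ← key, Finset.mul_sum]
  exact Finset.sum_congr rfl fun a _ => by ring

theorem exists_tendsto_card_hasseCommonZeros (D : Fin l → RatFunc Fq) {r : ℕ}
    (hr : Nat.card {a : Fin l → ZMod p //
      ∃ F : RatFunc Fq, (∑ i, ((a i).val : RatFunc Fq) * D i) = F ^ p - F} = p ^ r) :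
    ∃ B : ℝ, ((∀ (a : Fin l → ZMod p) (F : RatFunc Fq) (c : Fq),
        (∑ i, ((a i).val : RatFunc Fq) * D i) = F ^ p - F + RatFunc.C c →
        ∃ F : RatFunc Fq, (∑ i, ((a i).val : RatFunc Fq) * D i) = F ^ p - F) → B = 0) ∧
      Tendsto (fun n : ℕ => (n * (hasseCommonZeros p n D).card : ℝ) / Nat.card Fq ^ n -
        (p ^ r / p ^ l + B * ((if p ∣ n then (p : ℝ) else 0) - 1))) atTop (nhds 0) := by
  classical
  have hp : (1 : ℝ) < p := by exact_mod_cast (Fact.out : p.Prime).one_lt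
  set D' : (Fin l → ZMod p) → RatFunc Fq := fun a => ∑ i, ((a i).val : RatFunc Fq) * D i
  set H := Finset.univ.filter fun a => ∃ F : RatFunc Fq, D' a = F ^ p - F
  set G := Finset.univ.filter fun a => (¬ ∃ F : RatFunc Fq, D' a = F ^ p - F) ∧
    ∃ (F : RatFunc Fq) (c : Fq), D' a = F ^ p - F + RatFunc.C c
  have hH : H.card = p ^ r := by
    rw [← hr]
    exact (Nat.subtype_card H fun a => by simp [H, D']).symm
  refine ⟨G.card / ((p - 1) * p ^ l), fun h => ?_, ?_⟩
  · have hG : G = ∅ := Finset.filter_false_of_mem fun a _ ⟨h1, F, c, h2⟩ => h1 (h a F c h2)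
    rw [hG, Finset.card_empty, Nat.cast_zero, zero_div]
  · refine (tendsto_card_hasseCommonZeros (p := p) D).congr fun n => ?_
    have hsum : ∑ a, (p * hasseProportion p (D' a) n - 1 : ℝ) =
        (p - 1) * H.card + G.card * ((if p ∣ n then (p : ℝ) else 0) - 1) := by
      have : ∀ a, (p * hasseProportion p (D' a) n - 1 : ℝ) =
          (p - 1) * (if a ∈ H then 1 else 0) +
            (if a ∈ G then 1 else 0) * ((if p ∣ n then (p : ℝ) else 0) - 1) := by
        intro a
        simp only [H, G, Finset.mem_filter, Finset.mem_univ, true_and, hasseProportion]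
        by_cases h1 : ∃ F : RatFunc Fq, D' a = F ^ p - F
        · simp [h1]
        · by_cases h2 : ∃ (F : RatFunc Fq) (c : Fq), D' a = F ^ p - F + RatFunc.C c
          · simp only [h1, h2, if_true, if_false, not_false_eq_true, true_and]
            split_ifs <;> simp
          · simp only [h1, h2, if_false, and_false]
            field_simp
            ring
      rw [Finset.sum_congr rfl fun a _ => this a, Finset.sum_add_distrib, ← Finset.mul_sum,
        ← Finset.sum_mul, Finset.sum_boole, Finset.sum_boole, Finset.filter_univ_mem,
        Finset.filter_univ_mem]
    rw [hsum, hH, add_div, mul_div_mul_left _ _ (by linarith), Nat.cast_pow]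
    ring

end combination

section logarithmicMean

theorem hasSum_pow_div_log {x : ℝ} (h0 : 0 ≤ x) (h1 : x < 1) :
    HasSum (fun n : ℕ => x ^ n / n) (-Real.log (1 - x)) := by
  have h := Real.hasSum_pow_div_log_of_abs_lt_one (abs_lt.2 ⟨by linarith, h1⟩)
  rw [← hasSum_nat_add_iff' 1]
  simpa using h

theorem hasSum_dvd_pow_div_log {p : ℕ} (hp : p ≠ 0) {x : ℝ} (h0 : 0 ≤ x) (h1 : x < 1) :
    HasSum (fun n : ℕ => (if p ∣ n then (p : ℝ) else 0) * (x ^ n / n))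
      (-Real.log (1 - x ^ p)) := by
  have h := hasSum_pow_div_log (pow_nonneg h0 p) (pow_lt_one₀ h0 h1 hp)
  rw [← Function.Injective.hasSum_iff (mul_right_injective₀ hp)]
  · convert h using 2 with n
    simp only [Function.comp_apply, dvd_mul_right, if_true, Nat.cast_mul, pow_mul]
    field_simp
  · rintro n hn
    rw [if_neg, zero_mul]
    rintro ⟨m, rfl⟩
    exact hn ⟨m, rfl⟩

theorem tendsto_neg_log_one_sub_atTop :
    Tendsto (fun x : ℝ => -Real.log (1 - x)) (nhdsWithin 1 (Set.Iio 1)) atTop := by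
  refine tendsto_neg_atBot_atTop.comp (Real.tendsto_log_nhdsGT_zero.comp ?_)
  refine tendsto_nhdsWithin_iff.2 ⟨?_, ?_⟩
  · have : Tendsto (fun x : ℝ => 1 - x) (nhds 1) (nhds (1 - 1)) :=
      tendsto_const_nhds.sub tendsto_id
    rw [sub_self] at this
    exact this.mono_left nhdsWithin_le_nhds
  · filter_upwards [self_mem_nhdsWithin] with x hx
    exact sub_pos.2 (Set.mem_Iio.1 hx)

theorem summable_mul_pow_div {θ : ℕ → ℝ} {K : ℝ} (hθ : ∀ n, |θ n| ≤ K) {x : ℝ} (h0 : 0 ≤ x)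
    (h1 : x < 1) : Summable fun n : ℕ => θ n * (x ^ n / n) := by
  refine Summable.of_norm_bounded ((hasSum_pow_div_log h0 h1).summable.mul_left K) fun n => ?_
  rw [norm_mul, Real.norm_eq_abs, Real.norm_of_nonneg (by positivity)]
  gcongr
  exact hθ n

/-- The logarithmic mean of a sequence converging to zero tends to zero. -/
theorem tendsto_logMean_zero {θ : ℕ → ℝ} (hθ : Tendsto θ atTop (nhds 0)) :
    Tendsto (fun x : ℝ => (∑' n : ℕ, θ n * (x ^ n / n)) / -Real.log (1 - x))
      (nhdsWithin 1 (Set.Iio 1)) (nhds 0) := by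
  obtain ⟨K, hK⟩ := hθ.abs.bddAbove_range
  have hK : ∀ n, |θ n| ≤ K := fun n => hK ⟨n, rfl⟩
  rw [Metric.tendsto_nhds]
  intro ε hε
  obtain ⟨N, hN⟩ := eventually_atTop.1 (Metric.tendsto_nhds.1 hθ (ε / 2) (half_pos hε))
  have hlog := tendsto_neg_log_one_sub_atTop.eventually_gt_atTop
    (max 0 ((∑ n ∈ Finset.range N, |θ n|) / (ε / 2)))
  filter_upwards [hlog, self_mem_nhdsWithin, mem_nhdsWithin_of_mem_nhds (Ioi_mem_nhds zero_lt_one)]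
    with x hx h1 h0
  rw [max_lt_iff] at hx
  obtain ⟨hpos, hx⟩ := hx
  have hx0 : 0 ≤ x := le_of_lt h0
  rw [Real.dist_eq, sub_zero, abs_div, abs_of_pos hpos, div_lt_iff₀ hpos]
  rw [div_lt_iff₀ (half_pos hε)] at hx
  have hle : ∀ n, |θ n| * (x ^ n / n) ≤
      (if n ∈ Finset.range N then |θ n| else 0) + ε / 2 * (x ^ n / n) := fun n => by
    have hnn : 0 ≤ x ^ n / n := by positivity
    split_ifs with hn
    · have : x ^ n / n ≤ 1 := by
        rcases n.eq_zero_or_pos with rfl | hn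
        · simp
        · exact div_le_one_of_le₀ ((pow_le_one₀ hx0 (le_of_lt h1)).trans
            (Nat.one_le_cast.2 hn)) (Nat.cast_nonneg n)
      nlinarith [abs_nonneg (θ n), mul_nonneg (half_pos hε).le hnn]
    · have := hN n (by simpa using hn)
      rw [Real.dist_eq, sub_zero] at this
      rw [zero_add]
      gcongr
  have hs1 : HasSum (fun n => if n ∈ Finset.range N then |θ n| else 0)
      (∑ n ∈ Finset.range N, |θ n|) := by
    have := hasSum_sum_of_ne_finset_zero (L := .unconditional ℕ) (f := fun n => if n ∈ Finset.range N then |θ n| else 0)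
      (s := Finset.range N) fun n hn => if_neg hn
    rwa [Finset.sum_congr rfl fun n hn => if_pos hn] at this
  have hs := hs1.add ((hasSum_pow_div_log hx0 h1).mul_left (ε / 2))
  have hs2 := summable_mul_pow_div (θ := fun n => |θ n|) (K := K) (by simpa using hK) hx0 h1
  calc |∑' n : ℕ, θ n * (x ^ n / n)| ≤ ∑' n : ℕ, |θ n| * (x ^ n / n) := by
        have := norm_tsum_le_tsum_norm (f := fun n : ℕ => θ n * (x ^ n / n))
          (by
            refine hs2.congr fun n => ?_
            rw [norm_mul, Real.norm_eq_abs, Real.norm_of_nonneg (by positivity)])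
        refine this.trans_eq (tsum_congr fun n => ?_)
        rw [norm_mul, Real.norm_eq_abs, Real.norm_of_nonneg (by positivity)]
    _ ≤ _ := hs2.tsum_le_tsum hle hs.summable
    _ = _ := hs.tsum_eq
    _ < _ := by linarith

/-- Logarithmic means detect the constant `A` in `θ n = A + B * (p * [p ∣ n] - 1) + o(1)`. -/
theorem tendsto_logMean {θ : ℕ → ℝ} {p : ℕ} (hp : p ≠ 0) {A B : ℝ}
    (hθ : Tendsto (fun n => θ n - (A + B * ((if p ∣ n then (p : ℝ) else 0) - 1))) atTop (nhds 0)) :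
    (∃ K, ∀ n, |θ n| ≤ K) ∧
    Tendsto (fun x : ℝ => (∑' n : ℕ, θ n * (x ^ n / n)) / -Real.log (1 - x))
      (nhdsWithin 1 (Set.Iio 1)) (nhds A) := by
  obtain ⟨K, hK⟩ := hθ.abs.bddAbove_range
  have hK : ∀ n, |θ n - (A + B * ((if p ∣ n then (p : ℝ) else 0) - 1))| ≤ K :=
    fun n => hK ⟨n, rfl⟩
  refine ⟨⟨K + (|A| + |B| * (p + 1)), fun n => ?_⟩, ?_⟩
  · rw [← sub_add_cancel (θ n) (A + B * ((if p ∣ n then (p : ℝ) else 0) - 1))]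
    refine (abs_add_le _ _).trans (add_le_add (hK n) ((abs_add_le _ _).trans ?_))
    rw [abs_mul]
    gcongr
    refine (abs_sub _ _).trans ?_
    rw [abs_one]
    gcongr
    split_ifs <;> simp
  · have hpoly : Tendsto (fun x : ℝ => -Real.log (∑ i ∈ Finset.range p, x ^ i))
        (nhdsWithin 1 (Set.Iio 1)) (nhds (-Real.log p)) := by
      have hc : ContinuousAt (fun x : ℝ => -Real.log (∑ i ∈ Finset.range p, x ^ i)) 1 := by
        refine (ContinuousAt.log ?_ ?_).neg
        · fun_prop
        · simpa using hp
      have := hc.tendsto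
      simp only [one_pow, Finset.sum_const, Finset.card_range, nsmul_eq_mul, mul_one] at this
      exact this.mono_left nhdsWithin_le_nhds
    have h := ((tendsto_logMean_zero hθ).add_const A).add
      ((hpoly.div_atTop tendsto_neg_log_one_sub_atTop).const_mul B)
    rw [zero_add, mul_zero, add_zero] at h
    refine h.congr' ?_
    filter_upwards [tendsto_neg_log_one_sub_atTop.eventually_gt_atTop 0, self_mem_nhdsWithin,
      mem_nhdsWithin_of_mem_nhds (Ioi_mem_nhds zero_lt_one)] with x hpos h1 h0
    have hx0 : 0 ≤ x := le_of_lt h0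
    have hx1 : x < 1 := h1
    have hlog : Real.log (1 - x ^ p) =
        Real.log (1 - x) + Real.log (∑ i ∈ Finset.range p, x ^ i) := by
      rw [← Real.log_mul (by linarith), mul_neg_geom_sum]
      have : (0 : ℝ) < ∑ i ∈ Finset.range p, x ^ i :=
        Finset.sum_pos (fun i _ => pow_pos h0 i) (by simpa using hp)
      exact this.ne'
    have hsum := (summable_mul_pow_div hK hx0 h1).hasSum.add
      (((hasSum_pow_div_log hx0 h1).mul_left A).add
      (((hasSum_dvd_pow_div_log hp hx0 h1).sub (hasSum_pow_div_log hx0 h1)).mul_left B))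
    have heq := (hsum.congr_fun (g := fun n : ℕ => θ n * (x ^ n / n)) fun n => by ring).tsum_eq
    rw [heq, hlog]
    generalize (∑' b : ℕ, (θ b - (A + B * ((if p ∣ b then (p : ℝ) else 0) - 1))) * (x ^ b / b)) = T
    have hne : Real.log (1 - x) ≠ 0 := (neg_pos.1 hpos).ne
    field_simp
    ring

end logarithmicMean

section dirichletSeries

theorem tsum_comp_natDegree {R : Type*} [Semiring R] {Q : R[X] → Prop} {S : ℕ → Finset R[X]}
    (hS : ∀ n P, P ∈ S n ↔ Q P ∧ P.natDegree = n) {g : ℕ → ℝ} (hg : ∀ n, 0 ≤ g n)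
    (hsum : Summable fun n => (S n).card * g n) :
    ∑' P : {P : R[X] // Q P}, g (P : R[X]).natDegree = ∑' n, (S n).card * g n := by
  let d : {P : R[X] // Q P} → ℕ := fun P => (P : R[X]).natDegree
  have hfib : ∀ n, ∃ _ : Finite {P // d P = n}, Nat.card {P // d P = n} = (S n).card := fun n => by
    have e : {P // d P = n} ≃ S n := (Equiv.subtypeSubtypeEquivSubtypeInter _ _).trans
      (Equiv.subtypeEquivRight fun P => (hS n P).symm)
    exact ⟨Finite.of_equiv _ e.symm, (Nat.card_congr e).trans (Nat.card_eq_finsetCard _)⟩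
  have hval : ∀ n, ∑' P : {P // d P = n}, g (d P) = (S n).card * g n := fun n => by
    rw [tsum_congr (g := fun _ => g n) fun P => by rw [P.2], tsum_const, (hfib n).2, nsmul_eq_mul]
  rw [← (Equiv.sigmaFiberEquiv d).tsum_eq fun P : {P : R[X] // Q P} => g (P : R[X]).natDegree]
  have hs : Summable fun P : (Σ n, {P // d P = n}) => g (d P.2) := by
    rw [summable_sigma_of_nonneg fun P => hg _]
    refine ⟨fun n => ?_, hsum.congr fun n => (hval n).symm⟩
    have := (hfib n).1
    exact Summable.of_finite
  exact hs.tsum_sigma.trans (tsum_congr hval)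

variable {Fq : Type*} [Field Fq] [Fintype Fq]

theorem tendsto_tsum_natDegree_rpow_div_log {Q : Fq[X] → Prop} {S : ℕ → Finset Fq[X]}
    (hS : ∀ n P, P ∈ S n ↔ Q P ∧ P.natDegree = n) (h0 : S 0 = ∅) {p : ℕ} (hp : p ≠ 0) {A B : ℝ}
    (hθ : Tendsto (fun n => (n * (S n).card : ℝ) / Nat.card Fq ^ n -
      (A + B * ((if p ∣ n then (p : ℝ) else 0) - 1))) atTop (nhds 0)) :
    Tendsto (fun s : ℝ => (∑' P : {P : Fq[X] // Q P},
        ((Fintype.card Fq : ℝ) ^ (P : Fq[X]).natDegree) ^ (-s)) /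
        -Real.log (1 - (Fintype.card Fq : ℝ) ^ (1 - s)))
      (nhdsWithin 1 (Set.Ioi (1 : ℝ))) (nhds A) := by
  have hq : (1 : ℝ) < Fintype.card Fq := by exact_mod_cast Fintype.one_lt_card
  rw [Nat.card_eq_fintype_card] at hθ
  set q : ℝ := (Fintype.card Fq : ℝ)
  have hq0 : 0 < q := by linarith
  obtain ⟨⟨K, hK⟩, hlim⟩ := tendsto_logMean hp hθ
  have hx1 : ∀ s : ℝ, 1 < s → q ^ (1 - s) < 1 := fun s hs =>
    Real.rpow_lt_one_of_one_lt_of_neg hq (by linarith)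
  have hx : Tendsto (fun s : ℝ => q ^ (1 - s)) (nhdsWithin 1 (Set.Ioi 1))
      (nhdsWithin 1 (Set.Iio 1)) := by
    refine tendsto_nhdsWithin_iff.2 ⟨?_, ?_⟩
    · have hc : ContinuousAt (fun s : ℝ => q ^ (1 - s)) 1 :=
        ContinuousAt.rpow continuousAt_const (by fun_prop) (Or.inl hq0.ne')
      have := hc.tendsto
      simp only [sub_self, Real.rpow_zero] at this
      exact this.mono_left nhdsWithin_le_nhds
    · filter_upwards [self_mem_nhdsWithin] with s hs using hx1 s hs
  refine (hlim.comp hx).congr' ?_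
  filter_upwards [self_mem_nhdsWithin] with s hs
  have hterm : ∀ n : ℕ, (n * (S n).card : ℝ) / q ^ n * ((q ^ (1 - s)) ^ n / n) =
      (S n).card * (q ^ n) ^ (-s) := fun n => by
    rcases eq_or_ne n 0 with rfl | hn
    · simp [h0]
    · have hpow : (q ^ (1 - s)) ^ n = q ^ n * (q ^ n) ^ (-s) := by
        rw [← Real.rpow_natCast, ← Real.rpow_natCast, ← Real.rpow_mul hq0.le,
          ← Real.rpow_mul hq0.le, ← Real.rpow_add hq0]
        congr 1
        ring
      rw [hpow]
      field_simp
  have hsum := summable_mul_pow_div hK (Real.rpow_nonneg hq0.le _) (hx1 s hs)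
  rw [Function.comp_apply, tsum_congr hterm, tsum_comp_natDegree hS (g := fun n => (q ^ n) ^ (-s))
    (fun n => by positivity) (hsum.congr hterm)]

end dirichletSeries

section density

variable {p : ℕ} [Fact p.Prime] {Fq : Type} [Field Fq] [Fintype Fq] [Algebra (ZMod p) Fq] {l : ℕ}

theorem monicIrreducibles_zero : monicIrreducibles Fq 0 = ∅ :=
  Finset.eq_empty_of_forall_notMem fun _ hP =>
    (mem_monicIrreducibles.1 hP).2.1.natDegree_pos.ne' (mem_monicIrreducibles.1 hP).2.2

/-- The monic irreducible polynomials of degree `n` prime to the denominators of the `D i`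
and at which all the `D i` have vanishing Hasse symbol. -/
noncomputable def hasseZeros (p : ℕ) [Fact p.Prime] {Fq : Type} [Field Fq] [Fintype Fq]
    [Algebra (ZMod p) Fq] {l : ℕ} (n : ℕ) (D : Fin l → RatFunc Fq) : Finset Fq[X] :=
  open Classical in
  (monicIrreducibles Fq n).filter fun P => (∀ i, ¬ P ∣ (D i).denom) ∧
    ∀ i, hasseSymbol p P (D i) = 0

theorem mem_hasseZeros {n : ℕ} {D : Fin l → RatFunc Fq} {P : Fq[X]} :
    P ∈ hasseZeros p n D ↔ (P.Monic ∧ Irreducible P ∧ (∀ i, ¬ P ∣ (D i).denom) ∧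
      ∀ i, hasseSymbol p P (D i) = 0) ∧ P.natDegree = n := by
  classical
  rw [hasseZeros, Finset.mem_filter, mem_monicIrreducibles]
  tauto

theorem hasseZeros_eventuallyEq (D : Fin l → RatFunc Fq) :
    ∀ᶠ n in atTop, hasseCommonZeros p n D = hasseZeros p n D := by
  have hden : ∀ᶠ n in atTop, ∀ i, (D i).denom.natDegree < n :=
    eventually_all.2 fun i => eventually_gt_atTop _
  filter_upwards [hden] with n hn
  classical
  ext P
  rw [hasseCommonZeros, hasseZeros, Finset.mem_filter, Finset.mem_filter]
  exact and_congr_right fun hP => (and_iff_right fun i =>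
    not_dvd_of_mem_monicIrreducibles hP (D i).denom_ne_zero (hn i)).symm

end density

/-- **Dirichlet (and relative) density of simultaneous vanishing of Hasse symbols
(Theorem 4.4).**
Let `q` be a power of a prime `p`, `k = F_q(t)`, `S = {D_1,...,D_l}` nonzero elements of
`k`, and `γ_S = p^r` the cardinality of
`{(a_1,...,a_l) ∈ F_p^l : a_1 D_1 + ⋯ + a_l D_l = F^p − F for some F ∈ k}`.
Let `M` be the set of monic irreducible `P` (with `ord_P(D_i) ≥ 0` for all `i`) such that
`{D_1/P} = ⋯ = {D_l/P} = 0`.  Then the Dirichlet density of `M` equals `1/p^{l−r}`, i.e.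
`lim_{s→1⁺} (Σ_{P∈M} NP^{−s})/(Σ_P NP^{−s}) = 1/p^{l−r}` where `NP = q^{deg P}`.
Moreover, if `K = k(α_1,...,α_l)` with `α_i^p − α_i = D_i` is a geometric extension of
`k`, then the relative density of `M` also equals `1/p^{l−r}`. -/
theorem artinSchreier_dirichlet_density
    (p e : ℕ) (hp : p.Prime) (he : 0 < e)
    (Fq : Type) [Field Fq] [Fintype Fq] (hq : Fintype.card Fq = p ^ e)
    [Algebra (ZMod p) Fq]
    (l : ℕ) (D : Fin l → RatFunc Fq) (hD : ∀ i, D i ≠ 0)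
    -- `γ_S = p^r`
    (r : ℕ) (hrl : r ≤ l)
    (hr : Nat.card {a : Fin l → ZMod p //
      ∃ F : RatFunc Fq, (∑ i, ((a i).val : RatFunc Fq) * D i) = F ^ p - F} = p ^ r)
    -- `K = k(α_1,...,α_l)` with `α_i^p − α_i = D_i`
    (K : Type) [Field K] [Algebra (RatFunc Fq) K] [Algebra Fq K]
    [IsScalarTower Fq (RatFunc Fq) K]
    (α : Fin l → K)
    (hα : ∀ i, α i ^ p - α i = algebraMap (RatFunc Fq) K (D i))
    (hgen : Algebra.adjoin (RatFunc Fq) (Set.range α) = ⊤) :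
    -- the Dirichlet density of `M` is `1/p^{l−r}` ...
    Tendsto (fun s : ℝ =>
        (∑' P : {P : Polynomial Fq // P.Monic ∧ Irreducible P ∧
            (∀ i, ¬ P ∣ (D i).denom) ∧ ∀ i, hasseSymbol p P (D i) = 0},
            ((Fintype.card Fq : ℝ) ^ (P : Polynomial Fq).natDegree) ^ (-s)) /
          (∑' P : {P : Polynomial Fq // P.Monic ∧ Irreducible P},
            ((Fintype.card Fq : ℝ) ^ (P : Polynomial Fq).natDegree) ^ (-s)))
      (nhdsWithin 1 (Set.Ioi (1 : ℝ))) (nhds (1 / (p : ℝ) ^ (l - r))) ∧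
    -- ... and if `K/k` is geometric, the relative density of `M` is also `1/p^{l−r}`
    ((∀ x : K, IsAlgebraic Fq x → ∃ c : Fq, algebraMap Fq K c = x) →
      Tendsto (fun N : ℕ =>
          (Nat.card {P : Polynomial Fq //
              P.Monic ∧ Irreducible P ∧ P.natDegree = N ∧
                (∀ i, ¬ P ∣ (D i).denom) ∧ ∀ i, hasseSymbol p P (D i) = 0} : ℝ) /
            (Nat.card {P : Polynomial Fq //
              P.Monic ∧ Irreducible P ∧ P.natDegree = N} : ℝ))
        atTop (nhds (1 / (p : ℝ) ^ (l - r)))) := by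
  have : Fact p.Prime := ⟨hp⟩
  have hp0 : (0 : ℝ) < p := by exact_mod_cast hp.pos
  obtain ⟨B, hB, hlim⟩ := exists_tendsto_card_hasseCommonZeros (p := p) D hr
  have hpow : (p : ℝ) ^ r / p ^ l = 1 / (p : ℝ) ^ (l - r) := by
    rw [pow_sub₀ _ hp0.ne' hrl]
    field_simp
  rw [hpow] at hlim
  have hM : Tendsto (fun n : ℕ => (n * (hasseZeros p n D).card : ℝ) / Nat.card Fq ^ n -
      (1 / (p : ℝ) ^ (l - r) + B * ((if p ∣ n then (p : ℝ) else 0) - 1))) atTop (nhds 0) := by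
    refine hlim.congr' ?_
    filter_upwards [hasseZeros_eventuallyEq (p := p) D] with n hn
    rw [hn]
  have hw := tendsto_mul_card_monicIrreducibles_div (Fq := Fq)
  constructor
  · have h1 := tendsto_tsum_natDegree_rpow_div_log (fun n P => mem_hasseZeros (p := p) (D := D))
      (by simp [hasseZeros, monicIrreducibles_zero]) hp.ne_zero hM
    have h2 := tendsto_tsum_natDegree_rpow_div_log (S := monicIrreducibles Fq)
      (Q := fun P => P.Monic ∧ Irreducible P) (A := 1) (B := 0)
      (fun n P => by rw [mem_monicIrreducibles, and_assoc]) monicIrreducibles_zero hp.ne_zero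
      (by simpa using hw.sub_const 1)
    have h3 := h1.div h2 one_ne_zero
    rw [div_one] at h3
    refine h3.congr' ?_
    filter_upwards [self_mem_nhdsWithin] with s hs
    refine div_div_div_cancel_right₀ ?_ _ _
    have hq1 : (1 : ℝ) < Fintype.card Fq := by exact_mod_cast Fintype.one_lt_card
    have hx1 := Real.rpow_lt_one_of_one_lt_of_neg hq1 (sub_neg.2 (Set.mem_Ioi.1 hs))
    have hx0 := Real.rpow_pos_of_pos (zero_lt_one.trans hq1) (1 - s)
    exact (neg_pos.2 (Real.log_neg (by linarith) (by linarith))).ne'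
  · intro hgeom
    have hB0 : B = 0 := by
      refine hB fun a F c h => ?_
      have : CharP Fq p := charP_of_injective_algebraMap (algebraMap (ZMod p) Fq).injective p
      have : CharP (RatFunc Fq) p :=
        charP_of_injective_algebraMap (algebraMap Fq (RatFunc Fq)).injective p
      have : CharP K p := charP_of_injective_algebraMap (algebraMap Fq K).injective p
      set β : K := ∑ i, ((a i).val : K) * α i - algebraMap (RatFunc Fq) K F with hβ
      have hβc : β ^ p - β = algebraMap Fq K c := by
        have h1 : ∀ i, (((a i).val : K) * α i) ^ p = (a i).val * α i ^ p := fun i => by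
          have : (((a i).val : K)) ^ p = (a i).val := by
            have h2 := map_natCast (frobenius K p) (a i).val
            rwa [frobenius_def] at h2
          rw [mul_pow, this]
        have h3 := congrArg (algebraMap (RatFunc Fq) K) h
        simp only [map_sum, map_mul, map_natCast, ← hα, map_add, map_sub, map_pow] at h3
        rw [← RatFunc.algebraMap_eq_C, ← IsScalarTower.algebraMap_apply] at h3
        rw [hβ, sub_pow_char, sum_pow_char]
        simp only [h1]
        simp only [mul_sub, Finset.sum_sub_distrib] at h3
        linear_combination h3
      have halg : IsAlgebraic Fq β := by
        refine ⟨X ^ p - X - C c, ?_, by simp [hβc]⟩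
        have hm : (X ^ p - (X + C c) : Fq[X]).Monic :=
          monic_X_pow_sub ((degree_X_add_C c).trans_lt (by exact_mod_cast hp.one_lt))
        rw [sub_sub]
        exact hm.ne_zero
      obtain ⟨b, hb⟩ := hgeom β halg
      rw [← hb, ← map_pow, ← map_sub] at hβc
      have hbc := (algebraMap Fq K).injective hβc
      refine ⟨F + RatFunc.C b, ?_⟩
      rw [h, ← hbc, add_pow_char, map_sub, map_pow]
      ring
    have hM' : Tendsto (fun n : ℕ => (n * (hasseZeros p n D).card : ℝ) / Nat.card Fq ^ n) atTop
        (nhds (1 / (p : ℝ) ^ (l - r))) := by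
      simpa [hB0] using hM.add_const (1 / (p : ℝ) ^ (l - r))
    have h3 := hM'.div hw one_ne_zero
    rw [div_one] at h3
    refine h3.congr' ?_
    filter_upwards [eventually_ne_atTop 0] with n hn
    have hcM : Nat.card {P : Fq[X] // P.Monic ∧ Irreducible P ∧ P.natDegree = n ∧
        (∀ i, ¬ P ∣ (D i).denom) ∧ ∀ i, hasseSymbol p P (D i) = 0} = (hasseZeros p n D).card :=
      Nat.subtype_card _ fun P => by rw [mem_hasseZeros]; tauto
    have hcI : Nat.card {P : Fq[X] // P.Monic ∧ Irreducible P ∧ P.natDegree = n} =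
        (monicIrreducibles Fq n).card := Nat.subtype_card _ fun P => mem_monicIrreducibles
    rw [Pi.div_apply, hcM, hcI, div_div_div_cancel_right₀
      (pow_ne_zero _ (Nat.cast_ne_zero.2 Nat.card_pos.ne')),
      mul_div_mul_left _ _ (Nat.cast_ne_zero.2 hn)]
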